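/- Let I be an inner function with I(0)=0 and f an outer function in H² of unit norm whose associated pair is (Ib₀, a), with (b₀,a) special and (a/(1−b₀))² rigid. If g ∈ H² is outer and ker T_{ḡ/g} = fK_I, then ḡ/g = Ī f̄ / f almost everywhere on ∂𝔻 (after replacing I by a unimodular constant multiple). -/

import Mathlib

open Complex MeasureTheory Filter Set

noncomputable section

/-! ### Basic framework: Hardy spaces on the unit disk via boundary values -/

/-- The open unit disk in the complex plane. -/
def unitDisk : Set ℂ := Metric.ball 0 1

/-- The point `e^{iθ}` of the unit circle. -/
def uc (θ : ℝ) : ℂ := Complex.exp ((θ : ℂ) * Complex.I)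

/-- Lebesgue measure on the parameter interval `(0, 2π]` of the unit circle. -/
def bMeasure : Measure ℝ := volume.restrict (Set.Ioc 0 (2 * Real.pi))

/-- Radial limit of `f` at the boundary point `w` (`|w| = 1`). -/
def radLim (f : ℂ → ℂ) (w : ℂ) : ℂ :=
  limUnder (nhdsWithin (1 : ℝ) (Set.Iio 1)) fun r : ℝ => f ((r : ℂ) * w)

/-- The boundary value function of `f` on the unit circle. -/
def bdry (f : ℂ → ℂ) (θ : ℝ) : ℂ := radLim f (uc θ)

/-- Membership in the Hardy space `H²` of the unit disk. -/
def MemH2 (f : ℂ → ℂ) : Prop :=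
  DifferentiableOn ℂ f unitDisk ∧
    ∃ C : ℝ, ∀ r ∈ Set.Ico (0 : ℝ) 1,
      (∫ θ in (0:ℝ)..(2 * Real.pi), ‖f ((r : ℂ) * uc θ)‖ ^ 2) ≤ C

/-- Membership in the Hardy space `H¹` of the unit disk. -/
def MemH1 (f : ℂ → ℂ) : Prop :=
  DifferentiableOn ℂ f unitDisk ∧
    ∃ C : ℝ, ∀ r ∈ Set.Ico (0 : ℝ) 1,
      (∫ θ in (0:ℝ)..(2 * Real.pi), ‖f ((r : ℂ) * uc θ)‖) ≤ C

/-- Membership in `H^∞` (bounded holomorphic functions on the disk). -/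
def MemHinf (f : ℂ → ℂ) : Prop :=
  DifferentiableOn ℂ f unitDisk ∧ ∃ C : ℝ, ∀ z ∈ unitDisk, ‖f z‖ ≤ C

/-- The `H²` (normalized boundary `L²`) inner product `⟨f, g⟩`. -/
def bInner (f g : ℂ → ℂ) : ℂ :=
  (1 / (2 * (Real.pi : ℂ))) *
    ∫ θ in (0:ℝ)..(2 * Real.pi), bdry f θ * (starRingEnd ℂ) (bdry g θ)

/-- The squared `H²` norm, computed on the boundary. -/
def bNormSq (f : ℂ → ℂ) : ℝ :=
  (1 / (2 * Real.pi)) * ∫ θ in (0:ℝ)..(2 * Real.pi), ‖bdry f θ‖ ^ 2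

/-- `f` is an inner function. -/
def IsInner (f : ℂ → ℂ) : Prop :=
  DifferentiableOn ℂ f unitDisk ∧ (∀ z ∈ unitDisk, ‖f z‖ ≤ 1) ∧
    ∀ᵐ θ ∂bMeasure, ‖bdry f θ‖ = 1

/-- `f` is an outer function: it is, up to a unimodular constant, the Herglotz
exponential of the Poisson integral of `log |f*|`. -/
def IsOuter (f : ℂ → ℂ) : Prop :=
  DifferentiableOn ℂ f unitDisk ∧ ∃ c : ℂ, ‖c‖ = 1 ∧ ∀ z ∈ unitDisk,
    f z = c * Complex.exp ((1 / (2 * (Real.pi : ℂ))) *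
      ∫ θ in (0:ℝ)..(2 * Real.pi),
        ((uc θ + z) / (uc θ - z)) * ((Real.log ‖bdry f θ‖ : ℝ) : ℂ))

/-- `b` is a nonextreme point of the closed unit ball of `H^∞`:
`log (1 - |b|)` is integrable on the circle. -/
def Nonextreme (b : ℂ → ℂ) : Prop :=
  DifferentiableOn ℂ b unitDisk ∧ (∀ z ∈ unitDisk, ‖b z‖ ≤ 1) ∧
    Integrable (fun θ => Real.log (1 - ‖bdry b θ‖)) bMeasure

/-- `(b, a)` is a pair: `b` nonextreme, `a` outer, `|a|² + |b|² = 1` a.e. on the circle. -/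
def IsPair (b a : ℂ → ℂ) : Prop :=
  Nonextreme b ∧ IsOuter a ∧
    ∀ᵐ θ ∂bMeasure, ‖bdry a θ‖ ^ 2 + ‖bdry b θ‖ ^ 2 = 1

/-- `(b, a)` is the pair associated with the outer function `f` of unit `H²` norm:
`f = a / (1 - b)`. -/
def PairAssoc (f b a : ℂ → ℂ) : Prop :=
  IsOuter f ∧ MemH2 f ∧ bNormSq f = 1 ∧ IsPair b a ∧
    ∀ z ∈ unitDisk, f z = a z / (1 - b z)

/-- The Herglotz measure `μ_λ` of `(1 + λ̄b)/(1 − λ̄b)` is absolutely continuous: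
the Herglotz representation holds with density `|a/(1 − λ̄b)|²` and no singular part. -/
def HerglotzAC (b a : ℂ → ℂ) (lam : ℂ) : Prop :=
  ∀ z ∈ unitDisk,
    (1 + (starRingEnd ℂ) lam * b z) / (1 - (starRingEnd ℂ) lam * b z) =
      (1 / (2 * (Real.pi : ℂ))) *
        (∫ θ in (0:ℝ)..(2 * Real.pi),
          ((1 + (uc θ)⁻¹ * z) / (1 - (uc θ)⁻¹ * z)) *
            ((‖bdry (fun w => a w / (1 - (starRingEnd ℂ) lam * b w)) θ‖ ^ 2 : ℝ) : ℂ)) +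
      Complex.I *
        ((((1 + (starRingEnd ℂ) lam * b 0) / (1 - (starRingEnd ℂ) lam * b 0)).im : ℝ) : ℂ)

/-- The pair `(b, a)` is special: the Herglotz measure of `(1+b)/(1−b)` is
absolutely continuous. -/
def SpecialPair (b a : ℂ → ℂ) : Prop := IsPair b a ∧ HerglotzAC b a 1

/-- `F ∈ H¹` is rigid: the only functions of `H¹` with the same argument a.e. on the
circle are the positive scalar multiples of `F`. -/
def Rigid (F : ℂ → ℂ) : Prop :=
  MemH1 F ∧ ∀ G : ℂ → ℂ, MemH1 G →
    (∀ᵐ θ ∂bMeasure, ∃ t : ℝ, 0 < t ∧ bdry G θ = (t : ℂ) * bdry F θ) →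
    ∃ c : ℝ, 0 < c ∧ ∀ z ∈ unitDisk, G z = (c : ℂ) * F z

/-- The Riesz (analytic) projection `P₊` of a boundary function, realized through the
Szegő integral: `(P₊u)(z) = (1/2π) ∫ u(θ) (1 − z e^{-iθ})⁻¹ dθ`. -/
def szProj (u : ℝ → ℂ) : ℂ → ℂ := fun z =>
  (1 / (2 * (Real.pi : ℂ))) *
    ∫ θ in (0:ℝ)..(2 * Real.pi), u θ * (1 - z * (uc θ)⁻¹)⁻¹

/-- The Toeplitz operator with boundary symbol `φ`: `T_φ h = P₊(φ · h*)`. -/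
def toeplitz (φ : ℝ → ℂ) (h : ℂ → ℂ) : ℂ → ℂ := szProj fun θ => φ θ * bdry h θ

/-- The kernel of the Toeplitz operator `T_φ`, as a subset of `H²`. -/
def toeplitzKer (φ : ℝ → ℂ) : Set (ℂ → ℂ) :=
  {h | MemH2 h ∧ ∀ z ∈ unitDisk, toeplitz φ h z = 0}

/-- The boundary symbol `ḡ` of a function `g` on the disk. -/
def conjBdry (g : ℂ → ℂ) : ℝ → ℂ := fun θ => (starRingEnd ℂ) (bdry g θ)

/-- The boundary symbol `ḡ/g`. -/
def symbQuot (g : ℂ → ℂ) : ℝ → ℂ := fun θ => (starRingEnd ℂ) (bdry g θ) / bdry g θ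

/-- The boundary symbol `Ī f̄ / f`. -/
def symbIf (I f : ℂ → ℂ) : ℝ → ℂ :=
  fun θ => (starRingEnd ℂ) (bdry I θ) * (starRingEnd ℂ) (bdry f θ) / bdry f θ

/-- The model space `K_I = H² ⊖ I H² = ker T_Ī` of an inner function `I`. -/
def modelSpace (I : ℂ → ℂ) : Set (ℂ → ℂ) := toeplitzKer (conjBdry I)

/-- The set `f·K_I`. -/
def fModel (f I : ℂ → ℂ) : Set (ℂ → ℂ) :=
  {g | ∃ h ∈ modelSpace I, ∀ z ∈ unitDisk, g z = f z * h z}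

/-- The orthogonal complement `ker T_{Ī f̄/f} ⊖ f·K_I` of `f·K_I` in the kernel of
`T_{Ī f̄/f}`, with respect to the `H²` inner product. -/
def kerPerp (I f : ℂ → ℂ) : Set (ℂ → ℂ) :=
  {h | h ∈ toeplitzKer (symbIf I f) ∧ ∀ g ∈ fModel f I, bInner h g = 0}

/-- `M(a) = T_a H² = a·H²` (for `a ∈ H^∞`), the range of `T_a`, as a set. -/
def rangeMa (a : ℂ → ℂ) : Set (ℂ → ℂ) :=
  {g | ∃ h, MemH2 h ∧ ∀ z ∈ unitDisk, g z = a z * h z}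

/-- Membership in the de Branges–Rovnyak space `H(b)` for nonextreme `b` with
pair `(b, a)`:  `h ∈ H(b)` iff `h ∈ H²` and `T_b̄ h = T_ā h⁺` for some `h⁺ ∈ H²`
(Sarason's characterization). -/
def MemHb (b a h : ℂ → ℂ) : Prop :=
  MemH2 h ∧ ∃ h' : ℂ → ℂ, MemH2 h' ∧
    ∀ z ∈ unitDisk, toeplitz (conjBdry b) h z = toeplitz (conjBdry a) h' z

/-- The function `h⁺ ∈ H²` with `T_b̄ h = T_ā h⁺` (unique when it exists, since `a`
is outer). -/
def plusFun (b a h : ℂ → ℂ) : ℂ → ℂ :=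
  Classical.epsilon fun h' : ℂ → ℂ => MemH2 h' ∧
    ∀ z ∈ unitDisk, toeplitz (conjBdry b) h z = toeplitz (conjBdry a) h' z

/-- The inner product of `H(b)`: `⟨h, g⟩_b = ⟨h, g⟩₂ + ⟨h⁺, g⁺⟩₂`. -/
def hbInner (b a h g : ℂ → ℂ) : ℂ :=
  bInner h g + bInner (plusFun b a h) (plusFun b a g)

/-- The squared norm of `H(b)`. -/
def hbNormSq (b a h : ℂ → ℂ) : ℝ := (hbInner b a h h).re

/-- The closure of a set `S` in the norm of `H(b)`. -/
def hbClosure (b a : ℂ → ℂ) (S : Set (ℂ → ℂ)) : Set (ℂ → ℂ) :=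
  {h | MemHb b a h ∧ ∀ ε : ℝ, 0 < ε → ∃ g ∈ S,
    hbNormSq b a (fun z => h z - g z) < ε}

/-- The orthogonal complement of `S` in `H(b)`. -/
def hbPerp (b a : ℂ → ℂ) (S : Set (ℂ → ℂ)) : Set (ℂ → ℂ) :=
  {h | MemHb b a h ∧ ∀ g ∈ S, hbInner b a h g = 0}

/-- A set of functions on the disk is a `k`-dimensional linear subspace. -/
def HasDimOn (S : Set (ℂ → ℂ)) (k : ℕ) : Prop :=
  ∃ g : Fin k → (ℂ → ℂ), (∀ j, g j ∈ S) ∧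
    (∀ c : Fin k → ℂ, (∀ z ∈ unitDisk, (∑ j, c j * g j z) = 0) → c = 0) ∧
    ∀ h ∈ S, ∃ c : Fin k → ℂ, ∀ z ∈ unitDisk, h z = ∑ j, c j * g j z

/-- The Szegő kernel `k_w(z) = (1 - w̄ z)⁻¹` of `H²`. -/
def szKernel (w z : ℂ) : ℂ := (1 - (starRingEnd ℂ) w * z)⁻¹

/-- The reproducing kernel of `H(b)` at an interior point `w ∈ 𝔻`. -/
def hbKernel (b : ℂ → ℂ) (w z : ℂ) : ℂ :=
  (1 - (starRingEnd ℂ) (b w) * b z) / (1 - (starRingEnd ℂ) w * z)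

/-- The boundary kernel of `H(b)` at a boundary point `z₀`, defined through the
nontangential limit `b(z₀) = radLim b z₀`. -/
def hbBoundaryKernel (b : ℂ → ℂ) (z₀ z : ℂ) : ℂ :=
  (1 - (starRingEnd ℂ) (radLim b z₀) * b z) / (1 - (starRingEnd ℂ) z₀ * z)

/-- `u` is a nontangential approach sequence to the boundary point `z₀`. -/
def NTApproach (u : ℕ → ℂ) (z₀ : ℂ) : Prop :=
  (∀ n, u n ∈ unitDisk) ∧ Filter.Tendsto u Filter.atTop (nhds z₀) ∧
    ∃ M : ℝ, ∀ n, ‖u n - z₀‖ ≤ M * (1 - ‖u n‖)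

/-- `b` has an angular derivative in the sense of Carathéodory at `z₀ ∈ ∂𝔻`. -/
def HasADC (b : ℂ → ℂ) (z₀ : ℂ) : Prop :=
  ‖radLim b z₀‖ = 1 ∧ ∃ L : ℂ, ∀ u : ℕ → ℂ, NTApproach u z₀ →
    Filter.Tendsto (fun n => b (u n)) Filter.atTop (nhds (radLim b z₀)) ∧
    Filter.Tendsto (fun n => (b (u n) - radLim b z₀) / (u n - z₀)) Filter.atTop (nhds L)

/-- The Poisson kernel of the disk as a function of the radius and the angle. -/
def pk (r s : ℝ) : ℝ := (1 - r ^ 2) / (1 - 2 * r * Real.cos s + r ^ 2)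

lemma pk_den_pos {r : ℝ} (h0 : 0 ≤ r) (h1 : r < 1) (s : ℝ) :
    0 < 1 - 2 * r * Real.cos s + r ^ 2 := by
  nlinarith [Real.cos_le_one s, mul_nonneg h0 (sub_nonneg.2 (Real.cos_le_one s))]

lemma pk_nonneg {r : ℝ} (h0 : 0 ≤ r) (h1 : r < 1) (s : ℝ) : 0 ≤ pk r s :=
  div_nonneg (by nlinarith) (pk_den_pos h0 h1 s).le

/-- The angular derivative of the Poisson kernel. -/
def pkDeriv (r s : ℝ) : ℝ :=
  -((1 - r ^ 2) * (2 * r * Real.sin s)) / (1 - 2 * r * Real.cos s + r ^ 2) ^ 2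

lemma hasDerivAt_pk {r : ℝ} (h0 : 0 ≤ r) (h1 : r < 1) (s : ℝ) :
    HasDerivAt (pk r) (pkDeriv r s) s := by
  have hd := pk_den_pos h0 h1 s
  have h : HasDerivAt (fun s => 1 - 2 * r * Real.cos s + r ^ 2) (2 * r * Real.sin s) s := by
    have := (((Real.hasDerivAt_cos s).const_mul (2 * r)).const_sub 1).add_const (r ^ 2)
    exact this.congr_deriv (by ring)
  have := (hasDerivAt_const s (1 - r ^ 2)).div h hd.ne'
  exact this.congr_deriv (by simp [pkDeriv])

lemma continuous_pk {r : ℝ} (h0 : 0 ≤ r) (h1 : r < 1) : Continuous (pk r) :=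
  continuous_iff_continuousAt.2 fun s => (hasDerivAt_pk h0 h1 s).continuousAt

lemma continuous_pkDeriv {r : ℝ} (h0 : 0 ≤ r) (h1 : r < 1) : Continuous (pkDeriv r) := by
  unfold pkDeriv
  refine Continuous.div (by fun_prop) (by fun_prop) fun s => ?_
  exact pow_ne_zero _ (pk_den_pos h0 h1 s).ne'

lemma integral_pk_zero {r : ℝ} (h0 : 0 ≤ r) (h1 : r < 1) :
    ∫ s in (0 : ℝ)..(2 * Real.pi), pk r s = 2 * Real.pi := by
  have h := DiffContOnCl.circleAverage_poissonKernel_smul' (f := fun _ : ℂ => (1 : ℝ → ℂ) 0)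
    (c := 0) (R := 1) (w := (r : ℂ)) diffContOnCl_const (by simp [abs_of_nonneg h0, h1])
  have e : ∀ θ : ℝ, ((‖circleMap 0 1 θ - 0‖ ^ 2 - ‖(r : ℂ) - 0‖ ^ 2) /
      ‖(circleMap 0 1 θ - 0) - ((r : ℂ) - 0)‖ ^ 2) = pk r θ := by
    intro θ
    have h2 : ‖(circleMap 0 1 θ - 0) - ((r : ℂ) - 0)‖ ^ 2 = 1 - 2 * r * Real.cos θ + r ^ 2 := by
      rw [← Complex.normSq_eq_norm_sq, Complex.normSq_apply]
      simp [circleMap, Complex.exp_ofReal_mul_I_re, Complex.exp_ofReal_mul_I_im]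
      nlinarith [Real.sin_sq_add_cos_sq θ]
    rw [h2]
    simp [pk]
  simp only [Real.circleAverage, e] at h
  simp only [Pi.one_apply, Complex.real_smul, mul_one, intervalIntegral.integral_ofReal] at h
  have hpi : (2 * Real.pi) ≠ 0 := by positivity
  have h' : (2 * Real.pi)⁻¹ * ∫ s in (0 : ℝ)..(2 * Real.pi), pk r s = 1 := by exact_mod_cast h
  field_simp at h'
  linarith

lemma periodic_pk (r : ℝ) : Function.Periodic (pk r) (2 * Real.pi) := fun s => by
  simp [pk]

lemma integral_pk {r : ℝ} (h0 : 0 ≤ r) (h1 : r < 1) (x : ℝ) :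
    ∫ s in (0 : ℝ)..(2 * Real.pi), pk r (s - x) = 2 * Real.pi := by
  rw [intervalIntegral.integral_comp_sub_right (pk r) x]
  have := (periodic_pk r).intervalIntegral_add_eq (0 - x) 0
  rw [zero_add, integral_pk_zero h0 h1] at this
  rw [show 2 * Real.pi - x = 0 - x + 2 * Real.pi by ring, this]

lemma pkDeriv_mul_sin_nonpos {r : ℝ} (h0 : 0 ≤ r) (h1 : r < 1) (s : ℝ) :
    pkDeriv r s * Real.sin s ≤ 0 := by
  have : pkDeriv r s * Real.sin s = -((1 - r ^ 2) * (2 * r) * (Real.sin s) ^ 2 /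
    (1 - 2 * r * Real.cos s + r ^ 2) ^ 2) := by
    unfold pkDeriv; ring
  rw [this, neg_nonpos]
  have : 0 ≤ 1 - r ^ 2 := by nlinarith
  positivity

lemma integral_pkDeriv_sin {r : ℝ} (h0 : 0 ≤ r) (h1 : r < 1) (x : ℝ) :
    ∫ s in (0 : ℝ)..(2 * Real.pi), |pkDeriv r (s - x)| * |Real.sin (s - x)| ≤ 2 * Real.pi := by
  have hc := continuous_pk h0 h1
  have hc' := continuous_pkDeriv h0 h1
  have hi : ∀ F : ℝ → ℝ, Continuous F → IntervalIntegrable F volume 0 (2 * Real.pi) :=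
    fun F hF => hF.intervalIntegrable _ _
  have h := intervalIntegral.integral_eq_sub_of_hasDerivAt (a := 0) (b := 2 * Real.pi)
    (f := fun s => pk r (s - x) * Real.sin (s - x))
    (f' := fun s => pkDeriv r (s - x) * Real.sin (s - x) + pk r (s - x) * Real.cos (s - x))
    (fun s _ => by
      have := ((hasDerivAt_pk h0 h1 (s - x)).mul (Real.hasDerivAt_sin (s - x))).comp s
        ((hasDerivAt_id s).sub_const x)
      simpa [Function.comp_def] using this)
    (Continuous.intervalIntegrable (by fun_prop) _ _)
  have e1 : pk r (2 * Real.pi - x) = pk r (0 - x) := by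
    rw [← periodic_pk r (0 - x)]; congr 1; ring
  have e2 : Real.sin (2 * Real.pi - x) = Real.sin (0 - x) := by
    rw [← Real.sin_add_two_pi (0 - x)]; congr 1; ring
  rw [e1, e2, sub_self, intervalIntegral.integral_add
    (hi (fun s => pkDeriv r (s - x) * Real.sin (s - x)) (by fun_prop))
    (hi (fun s => pk r (s - x) * Real.cos (s - x)) (by fun_prop))] at h
  have h3 : ∫ s in (0 : ℝ)..(2 * Real.pi), pk r (s - x) * Real.cos (s - x) ≤ 2 * Real.pi := by
    refine (intervalIntegral.integral_mono_on (by positivity)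
      (hi (fun s => pk r (s - x) * Real.cos (s - x)) (by fun_prop))
      (hi (fun s => pk r (s - x)) (by fun_prop)) fun s _ => ?_).trans_eq (integral_pk h0 h1 x)
    nlinarith [pk_nonneg h0 h1 (s - x), Real.cos_le_one (s - x)]
  have h4 : ∫ s in (0 : ℝ)..(2 * Real.pi), |pkDeriv r (s - x)| * |Real.sin (s - x)| =
      - ∫ s in (0 : ℝ)..(2 * Real.pi), pkDeriv r (s - x) * Real.sin (s - x) := by
    rw [← intervalIntegral.integral_neg]
    refine intervalIntegral.integral_congr fun s _ => ?_
    rw [← abs_mul, abs_of_nonpos (pkDeriv_mul_sin_nonpos h0 h1 _)]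
  rw [h4]; linarith

lemma abs_pkDeriv_mul_le {r : ℝ} (h0 : 0 < r) (h1 : r < 1) (s : ℝ) :
    |pkDeriv r s| * (1 - Real.cos s) ^ 2 ≤ (1 - r ^ 2) / (2 * r) := by
  have hd := pk_den_pos h0.le h1 s
  have hr : 0 < 1 - r ^ 2 := by nlinarith
  have hcos : 0 ≤ 1 - Real.cos s := sub_nonneg.2 (Real.cos_le_one s)
  have hle : 2 * r * (1 - Real.cos s) ≤ 1 - 2 * r * Real.cos s + r ^ 2 := by
    nlinarith [sq_nonneg (1 - r)]
  unfold pkDeriv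
  rw [abs_div, abs_neg, abs_mul, abs_mul, abs_of_pos hr, abs_of_pos (by positivity : 0 < 2 * r),
    abs_of_pos (pow_pos hd 2), div_mul_eq_mul_div, div_le_div_iff₀ (by positivity) (by positivity)]
  have hs : |Real.sin s| ≤ 1 := Real.abs_sin_le_one s
  have h2 : (2 * r * (1 - Real.cos s)) ^ 2 ≤ (1 - 2 * r * Real.cos s + r ^ 2) ^ 2 :=
    pow_le_pow_left₀ (by positivity) hle 2
  calc (1 - r ^ 2) * (2 * r * |Real.sin s|) * (1 - Real.cos s) ^ 2 * (2 * r)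
      = |Real.sin s| * ((1 - r ^ 2) * (2 * r * (1 - Real.cos s)) ^ 2) := by ring
    _ ≤ 1 * ((1 - r ^ 2) * (2 * r * (1 - Real.cos s)) ^ 2) := by gcongr
    _ ≤ _ := by rw [one_mul]; gcongr

lemma exists_bound_primitive {H : ℝ → ℝ} {x : ℝ} (hx : x ∈ Ioo 0 (2 * Real.pi))
    (hH : ContinuousOn H (Icc 0 (2 * Real.pi))) (hHx : H x = 0) (hd : HasDerivAt H 0 x)
    {ε : ℝ} (hε : 0 < ε) :
    ∃ C, 0 ≤ C ∧ ∀ t ∈ Icc 0 (2 * Real.pi),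
      |H t| ≤ ε * |Real.sin (t - x)| + C * (1 - Real.cos (t - x)) ^ 2 := by
  have h1 := (hasDerivAt_iff_isLittleO.1 hd).def (half_pos hε)
  obtain ⟨η, hη, hball⟩ := Metric.eventually_nhds_iff.1 h1
  set δ := min η 1 with hδ
  have hδ0 : 0 < δ := lt_min hη one_pos
  have hK : IsCompact (Icc 0 (2 * Real.pi) \ Ioo (x - δ) (x + δ)) :=
    isCompact_Icc.diff isOpen_Ioo
  have hpos : ∀ t ∈ Icc 0 (2 * Real.pi) \ Ioo (x - δ) (x + δ), 0 < 1 - Real.cos (t - x) := by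
    rintro t ⟨ht, ht'⟩
    rw [sub_pos]
    refine lt_of_le_of_ne (Real.cos_le_one _) fun hc => ?_
    rw [Real.cos_eq_one_iff_of_lt_of_lt (by linarith [ht.1, hx.2]) (by linarith [ht.2, hx.1])] at hc
    exact ht' ⟨by linarith, by linarith⟩
  obtain ⟨C, hC⟩ := hK.exists_bound_of_continuousOn
    (f := fun t => H t / (1 - Real.cos (t - x)) ^ 2)
    ((hH.mono sdiff_subset).div (by fun_prop) fun t ht => pow_ne_zero _ (hpos t ht).ne')
  refine ⟨max C 0, le_max_right _ _, fun t ht => ?_⟩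
  by_cases h : t ∈ Ioo (x - δ) (x + δ)
  · have hlt : |t - x| < δ := abs_sub_lt_iff.2 ⟨by linarith [h.2], by linarith [h.1]⟩
    have h2 := hball (y := t) (by rw [Real.dist_eq]; exact hlt.trans_le (min_le_left _ _))
    simp only [hHx, sub_zero, smul_zero, Real.norm_eq_abs] at h2
    have h3 : |t - x| ≤ 2 * |Real.sin (t - x)| := by
      have hl : |t - x| < 1 := hlt.trans_le (min_le_right _ _)
      have h4 := Real.mul_le_sin (abs_nonneg (t - x)) (by linarith [Real.pi_gt_three])
      have h5 : Real.sin |t - x| ≤ |Real.sin (t - x)| := by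
        rcases abs_cases (t - x) with ⟨e, _⟩ | ⟨e, _⟩
        · rw [e]; exact le_abs_self _
        · rw [e, Real.sin_neg]; exact neg_le_abs _
      have h6 : 1 / 2 ≤ 2 / Real.pi := by
        rw [div_le_div_iff₀ (by norm_num) Real.pi_pos]; linarith [Real.pi_le_four]
      nlinarith [abs_nonneg (t - x)]
    have : 0 ≤ max C 0 * (1 - Real.cos (t - x)) ^ 2 :=
      mul_nonneg (le_max_right _ _) (sq_nonneg _)
    nlinarith
  · have hp := hpos t ⟨ht, h⟩
    have h2 := hC t ⟨ht, h⟩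
    rw [Real.norm_eq_abs, abs_div, abs_of_pos (pow_pos hp 2), div_le_iff₀ (pow_pos hp 2)] at h2
    have : 0 ≤ ε * |Real.sin (t - x)| := by positivity
    have : C * (1 - Real.cos (t - x)) ^ 2 ≤ max C 0 * (1 - Real.cos (t - x)) ^ 2 := by
      gcongr; exact le_max_left _ _
    linarith

/-- **Fatou's theorem** for Poisson integrals of real integrable functions. -/
theorem ae_tendsto_poisson_real {v : ℝ → ℝ} (hv : IntervalIntegrable v volume 0 (2 * Real.pi)) :
    ∀ᵐ x, x ∈ Ioo 0 (2 * Real.pi) →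
      Tendsto (fun r => ∫ t in (0 : ℝ)..(2 * Real.pi), pk r (t - x) * v t)
        (nhdsWithin 1 (Iio 1)) (nhds (2 * Real.pi * v x)) := by
  have hpi : (0 : ℝ) ≤ 2 * Real.pi := by positivity
  filter_upwards [hv.ae_hasDerivAt_integral] with x hx hxI
  have hxI' : x ∈ uIcc 0 (2 * Real.pi) := by rw [uIcc_of_le hpi]; exact Ioo_subset_Icc_self hxI
  have hvd := hx hxI' x hxI'
  set w : ℝ → ℝ := fun t => v t - v x with hw
  have hwi : IntervalIntegrable w volume 0 (2 * Real.pi) := hv.sub intervalIntegrable_const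
  set H : ℝ → ℝ := fun t => ∫ s in x..t, w s with hH
  have hHac : AbsolutelyContinuousOnInterval H 0 (2 * Real.pi) :=
    hwi.absolutelyContinuousOnInterval_intervalIntegral hxI'
  have hHc : ContinuousOn H (Icc 0 (2 * Real.pi)) := by
    have := hHac.continuousOn
    rwa [uIcc_of_le hpi] at this
  have hHd : HasDerivAt H 0 x := by
    have h1 : HasDerivAt (fun t => (∫ s in x..t, v s) - v x * (t - x)) 0 x := by
      have := hvd.sub (((hasDerivAt_id x).sub_const x).const_mul (v x))
      exact this.congr_deriv (by simp)
    refine h1.congr_of_eventuallyEq ?_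
    filter_upwards [Ioo_mem_nhds hxI.1 hxI.2] with t ht
    have hvt : IntervalIntegrable v volume x t := hv.mono_set
      (by rw [uIcc_of_le hpi]; exact uIcc_subset_Icc (Ioo_subset_Icc_self hxI) (Ioo_subset_Icc_self ht))
    simp only [hH, hw]
    rw [intervalIntegral.integral_sub hvt intervalIntegrable_const]
    simp; ring
  have hderiv : ∀ᵐ t, t ∈ uIcc 0 (2 * Real.pi) → deriv H t = w t := by
    filter_upwards [hwi.ae_hasDerivAt_integral] with t ht htI
    exact (ht htI x hxI').deriv
  have key : ∀ r : ℝ, 0 ≤ r → r < 1 → (∫ t in (0 : ℝ)..(2 * Real.pi), pk r (t - x) * v t) -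
      2 * Real.pi * v x = pk r x * (H (2 * Real.pi) - H 0) -
        ∫ t in (0 : ℝ)..(2 * Real.pi), pkDeriv r (t - x) * H t := by
    intro r h0 h1
    have hkd : ∀ t, HasDerivAt (fun t => pk r (t - x)) (pkDeriv r (t - x)) t := fun t => by
      have := (hasDerivAt_pk h0 h1 (t - x)).comp t ((hasDerivAt_id t).sub_const x)
      simpa [Function.comp_def] using this
    have hc := continuous_pk h0 h1
    have hc' := continuous_pkDeriv h0 h1
    have hderk : deriv (fun t => pk r (t - x)) = fun t => pkDeriv r (t - x) :=
      funext fun t => (hkd t).deriv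
    have hkac : AbsolutelyContinuousOnInterval (fun t => pk r (t - x)) 0 (2 * Real.pi) := by
      refine ContDiffOn.absolutelyContinuousOnInterval (ContDiff.contDiffOn ?_)
      rw [contDiff_one_iff_deriv]
      refine ⟨fun t => (hkd t).differentiableAt, ?_⟩
      rw [hderk]; fun_prop
    have ibp := hkac.integral_mul_deriv_eq_deriv_mul hHac
    rw [hderk] at ibp
    have e0 : pk r (2 * Real.pi - x) = pk r x := by
      simp [pk, Real.cos_two_pi_sub]
    have e0' : pk r (0 - x) = pk r x := by simp [pk]
    have e1 : ∫ t in (0 : ℝ)..(2 * Real.pi), pk r (t - x) * deriv H t =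
        (∫ t in (0 : ℝ)..(2 * Real.pi), pk r (t - x) * v t) - 2 * Real.pi * v x := by
      have e2 : 2 * Real.pi * v x = ∫ t in (0 : ℝ)..(2 * Real.pi), pk r (t - x) * v x := by
        rw [intervalIntegral.integral_mul_const, integral_pk h0 h1 x]
      rw [e2, ← intervalIntegral.integral_sub]
      · refine intervalIntegral.integral_congr_ae ?_
        filter_upwards [hderiv] with t ht htI
        rw [ht (uIoc_subset_uIcc htI), hw]; ring
      · exact hv.continuousOn_mul (by fun_prop)
      · exact Continuous.intervalIntegrable (by fun_prop) _ _
    rw [← e1, ibp, e0, e0']; ring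
  rw [tendsto_iff_norm_sub_tendsto_zero]
  have hcos : Real.cos x < 1 := by
    refine lt_of_le_of_ne (Real.cos_le_one _) fun hc => ?_
    rw [Real.cos_eq_one_iff_of_lt_of_lt (by linarith [hxI.1]) (by linarith [hxI.2])] at hc
    linarith [hxI.1]
  have hpk0 : Tendsto (fun r => pk r x * (H (2 * Real.pi) - H 0)) (nhds 1) (nhds 0) := by
    have : ContinuousAt (fun r => pk r x * (H (2 * Real.pi) - H 0)) 1 := by
      unfold pk
      refine ContinuousAt.mul (ContinuousAt.div (by fun_prop) (by fun_prop) ?_) continuousAt_const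
      nlinarith
    have h2 := this.tendsto
    simpa [pk] using h2
  have hq0 : Tendsto (fun r : ℝ => (1 - r ^ 2) / (2 * r)) (nhds 1) (nhds 0) := by
    have : ContinuousAt (fun r : ℝ => (1 - r ^ 2) / (2 * r)) 1 :=
      ContinuousAt.div (by fun_prop) (by fun_prop) (by norm_num)
    simpa using this.tendsto
  rw [Metric.tendsto_nhds]
  intro ε hε
  obtain ⟨C, hC0, hC⟩ := exists_bound_primitive hxI hHc (by simp [hH]) hHd
    (ε := ε / (8 * Real.pi)) (by positivity)
  have l1 := (Metric.tendsto_nhds.1 hpk0) (ε / 4) (by positivity)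
  have l2 := (Metric.tendsto_nhds.1 (hq0.const_mul (C * (2 * Real.pi)))) (ε / 4) (by positivity)
  filter_upwards [nhdsWithin_le_nhds l1, nhdsWithin_le_nhds l2, self_mem_nhdsWithin,
    nhdsWithin_le_nhds (Ioi_mem_nhds (zero_lt_one (α := ℝ)))] with r hr1 hr2 hr3 hr4
  rw [key r (le_of_lt hr4) hr3]
  simp only [mul_zero, Real.dist_eq, sub_zero] at hr1 hr2
  have h0 : 0 < r := hr4
  have h1 : r < 1 := hr3
  have hc' := continuous_pkDeriv h0.le h1
  have hb : |∫ t in (0 : ℝ)..(2 * Real.pi), pkDeriv r (t - x) * H t| ≤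
      ε / (8 * Real.pi) * (2 * Real.pi) + C * (2 * Real.pi) * ((1 - r ^ 2) / (2 * r)) := by
    calc |∫ t in (0 : ℝ)..(2 * Real.pi), pkDeriv r (t - x) * H t|
        ≤ ∫ t in (0 : ℝ)..(2 * Real.pi), |pkDeriv r (t - x) * H t| :=
          intervalIntegral.abs_integral_le_integral_abs hpi
      _ ≤ ∫ t in (0 : ℝ)..(2 * Real.pi), (ε / (8 * Real.pi) *
            (|pkDeriv r (t - x)| * |Real.sin (t - x)|) + C * ((1 - r ^ 2) / (2 * r))) := by
          refine intervalIntegral.integral_mono_on hpi ?_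
            (Continuous.intervalIntegrable (by fun_prop) _ _) fun t ht => ?_
          · refine ContinuousOn.intervalIntegrable ?_
            rw [uIcc_of_le hpi]
            exact (ContinuousOn.mul (by fun_prop) hHc).abs
          · rw [abs_mul]
            have h2 := hC t ht
            have h3 := abs_pkDeriv_mul_le h0 h1 (t - x)
            calc |pkDeriv r (t - x)| * |H t| ≤ |pkDeriv r (t - x)| *
                  (ε / (8 * Real.pi) * |Real.sin (t - x)| + C * (1 - Real.cos (t - x)) ^ 2) := by
                  gcongr
              _ = ε / (8 * Real.pi) * (|pkDeriv r (t - x)| * |Real.sin (t - x)|) +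
                  C * (|pkDeriv r (t - x)| * (1 - Real.cos (t - x)) ^ 2) := by ring
              _ ≤ _ := by gcongr
      _ = ε / (8 * Real.pi) * (∫ t in (0 : ℝ)..(2 * Real.pi),
            (|pkDeriv r (t - x)| * |Real.sin (t - x)|)) +
            C * (2 * Real.pi) * ((1 - r ^ 2) / (2 * r)) := by
          rw [intervalIntegral.integral_add (Continuous.intervalIntegrable (by fun_prop) _ _)
            (Continuous.intervalIntegrable (by fun_prop) _ _), intervalIntegral.integral_const_mul]
          simp; ring
      _ ≤ _ := by gcongr; exact integral_pkDeriv_sin h0.le h1 x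
  have e : ε / (8 * Real.pi) * (2 * Real.pi) = ε / 4 := by
    field_simp; norm_num
  rw [e] at hb
  have hr2' := le_abs_self (C * (2 * Real.pi) * ((1 - r ^ 2) / (2 * r)))
  rw [Real.dist_eq, sub_zero, Real.norm_eq_abs, abs_abs]
  refine (abs_sub _ _).trans_lt ?_
  linarith

lemma norm_uc (θ : ℝ) : ‖uc θ‖ = 1 := Complex.norm_exp_ofReal_mul_I θ

lemma uc_ne_zero (θ : ℝ) : uc θ ≠ 0 := Complex.exp_ne_zero _

lemma conj_uc (θ : ℝ) : (starRingEnd ℂ) (uc θ) = (uc θ)⁻¹ :=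
  (Complex.inv_eq_conj (norm_uc θ)).symm

@[fun_prop] lemma continuous_uc : Continuous uc := by unfold uc; fun_prop

@[fun_prop] lemma continuous_uc_inv : Continuous fun θ => (uc θ)⁻¹ :=
  continuous_uc.inv₀ uc_ne_zero

instance : IsFiniteMeasure bMeasure := by unfold bMeasure; infer_instance

lemma bMeasure_univ : bMeasure.real univ = 2 * Real.pi := by
  simp [bMeasure, Measure.real, Real.pi_pos.le]

lemma integral_eq_bMeasure {E : Type*} [NormedAddCommGroup E] [NormedSpace ℝ E] (F : ℝ → E) :
    ∫ θ in (0 : ℝ)..(2 * Real.pi), F θ = ∫ θ, F θ ∂bMeasure :=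
  intervalIntegral.integral_of_le (by positivity)

lemma intervalIntegrable_iff_bMeasure {E : Type*} [NormedAddCommGroup E] (F : ℝ → E) :
    IntervalIntegrable F volume 0 (2 * Real.pi) ↔ Integrable F bMeasure :=
  intervalIntegrable_iff_integrableOn_Ioc_of_le (by positivity)

lemma Continuous.integrable_bMeasure {E : Type*} [NormedAddCommGroup E] {F : ℝ → E}
    (hF : Continuous F) : Integrable F bMeasure :=
  (intervalIntegrable_iff_bMeasure F).1 (hF.intervalIntegrable _ _)

/-- Term-by-term integration of a geometric series against an integrable function. -/
lemma hasSum_integral_geometric {v y : ℝ → ℂ} (hv : Integrable v bMeasure) (hy : Continuous y)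
    {ρ : ℝ} (hρ : ρ < 1) (hyρ : ∀ θ, ‖y θ‖ ≤ ρ) :
    HasSum (fun n : ℕ => ∫ θ, v θ * y θ ^ n ∂bMeasure) (∫ θ, v θ * (1 - y θ)⁻¹ ∂bMeasure) := by
  have hρ0 : 0 ≤ ρ := (norm_nonneg _).trans (hyρ 0)
  have hle : ∀ (n : ℕ) θ, ‖y θ ^ n‖ ≤ ρ ^ n := fun n θ => by
    rw [norm_pow]; exact pow_le_pow_left₀ (norm_nonneg _) (hyρ θ) n
  have hInt : ∀ n : ℕ, Integrable (fun θ => v θ * y θ ^ n) bMeasure := fun n =>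
    hv.mul_bdd (c := ρ ^ n) (hy.pow n).aestronglyMeasurable (ae_of_all _ (hle n))
  have h := hasSum_integral_of_summable_integral_norm (E := ℂ) (μ := bMeasure)
    (F := fun (n : ℕ) (θ : ℝ) => v θ * y θ ^ n) hInt ?_
  · have e : ∀ θ, v θ * (1 - y θ)⁻¹ = ∑' n : ℕ, v θ * y θ ^ n := fun θ => by
      rw [tsum_mul_left, tsum_geometric_of_norm_lt_one ((hyρ θ).trans_lt hρ)]
    simp_rw [e]
    exact h
  · refine Summable.of_nonneg_of_le (fun n => integral_nonneg fun θ => norm_nonneg _) (fun n => ?_)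
      ((summable_geometric_of_lt_one hρ0 hρ).mul_left (∫ θ, ‖v θ‖ ∂bMeasure))
    rw [← integral_mul_const]
    refine integral_mono (hInt n).norm (hv.norm.mul_const _) fun θ => ?_
    simp only [norm_mul]
    gcongr
    exact hle n θ

/-- The power series expansion of the Szegő projection. -/
lemma hasSum_szProj {v : ℝ → ℂ} (hv : Integrable v bMeasure) {z : ℂ} (hz : ‖z‖ < 1) :
    HasSum (fun n : ℕ => (1 / (2 * (Real.pi : ℂ)) * ∫ θ, v θ * ((uc θ)⁻¹) ^ n ∂bMeasure) * z ^ n)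
      (szProj v z) := by
  have h := hasSum_integral_geometric hv (y := fun θ => z * (uc θ)⁻¹) (by fun_prop) hz
    (fun θ => by simp [norm_uc])
  unfold szProj
  rw [integral_eq_bMeasure]
  have e : ∀ n : ℕ, (1 / (2 * (Real.pi : ℂ)) * ∫ θ, v θ * ((uc θ)⁻¹) ^ n ∂bMeasure) * z ^ n =
      1 / (2 * (Real.pi : ℂ)) * ∫ θ, v θ * (z * (uc θ)⁻¹) ^ n ∂bMeasure := fun n => by
    rw [mul_assoc, ← integral_mul_const]
    congr 2
    ext θ
    rw [mul_pow]; ring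
  simp_rw [e]
  exact h.mul_left _

lemma szProj_zero_apply (v : ℝ → ℂ) :
    szProj v 0 = 1 / (2 * (Real.pi : ℂ)) * ∫ θ, v θ ∂bMeasure := by
  unfold szProj; rw [integral_eq_bMeasure]; simp

lemma szProj_congr_ae {u v : ℝ → ℂ} (h : u =ᵐ[bMeasure] v) : szProj u = szProj v := by
  funext z
  unfold szProj
  rw [integral_eq_bMeasure, integral_eq_bMeasure]
  congr 1
  exact integral_congr_ae (h.mono fun θ hθ => by simp only [hθ])

/-- Boundary functions of the Hardy space `H²`: square integrable functions on the circle whose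
Fourier coefficients of negative index vanish. -/
def IsHardyBdry (v : ℝ → ℂ) : Prop :=
  MemLp v 2 bMeasure ∧ ∀ n : ℕ, ∫ θ, v θ * uc θ ^ (n + 1) ∂bMeasure = 0

lemma IsHardyBdry.integrable {v : ℝ → ℂ} (hv : IsHardyBdry v) : Integrable v bMeasure :=
  hv.1.integrable (by norm_num)

lemma pk_eq_add {r : ℝ} (h0 : 0 ≤ r) (h1 : r < 1) (x t : ℝ) :
    (pk r (t - x) : ℂ) = (1 - r * uc x * (uc t)⁻¹)⁻¹ +
      r * (uc x)⁻¹ * uc t * (1 - r * (uc x)⁻¹ * uc t)⁻¹ := by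
  have hn : ∀ a : ℂ, ‖a‖ = 1 → (1 - r * a) ≠ 0 := fun a ha h => by
    have : ‖(r : ℂ) * a‖ = 1 := by rw [← sub_eq_zero.1 h]; simp
    rw [norm_mul, ha, Complex.norm_real, Real.norm_of_nonneg h0] at this
    linarith
  have ha : uc t * (uc x)⁻¹ = uc (t - x) := by
    unfold uc; rw [← Complex.exp_neg, ← Complex.exp_add]; push_cast; ring_nf
  have hb : uc x * (uc t)⁻¹ = (uc (t - x))⁻¹ := by
    rw [← ha, mul_inv, inv_inv, mul_comm]
  rw [show (r : ℂ) * (uc x)⁻¹ * uc t = r * uc (t - x) by rw [← ha]; ring, mul_assoc, hb]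
  set w := uc (t - x) with hw
  have hw1 : w ≠ 0 := uc_ne_zero _
  have hA := hn w (norm_uc _)
  have hB := hn w⁻¹ (by rw [norm_inv, norm_uc, inv_one])
  have hc : (2 * Real.cos (t - x) : ℂ) = w + w⁻¹ := by
    rw [Complex.ofReal_cos, Complex.two_cos, hw]
    simp only [uc, ← Complex.exp_neg]
    push_cast
    ring_nf
  have hD : (1 - 2 * r * Real.cos (t - x) + r ^ 2 : ℂ) = (1 - r * w⁻¹) * (1 - r * w) := by
    have : w * w⁻¹ = 1 := mul_inv_cancel₀ hw1
    linear_combination (-(r : ℂ)) * hc - (r : ℂ) ^ 2 * this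
  unfold pk
  push_cast
  push_cast at hD
  rw [hD, inv_eq_one_div (1 - (r : ℂ) * w⁻¹), ← div_eq_mul_inv (r * w : ℂ) (1 - r * w),
    div_add_div _ _ hB hA]
  congr 1
  have : w * w⁻¹ = 1 := mul_inv_cancel₀ hw1
  linear_combination (r : ℂ) ^ 2 * this

/-- The Szegő projection of a Hardy boundary function is its Poisson integral. -/
lemma szProj_eq_poisson {v : ℝ → ℂ} (hv : IsHardyBdry v) {r : ℝ} (h0 : 0 ≤ r) (h1 : r < 1)
    (x : ℝ) : szProj v (r * uc x) =
      1 / (2 * (Real.pi : ℂ)) * ∫ t, v t * (pk r (t - x) : ℂ) ∂bMeasure := by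
  have hnr : ‖(r : ℂ)‖ = r := by rw [Complex.norm_real, Real.norm_of_nonneg h0]
  have hi := hv.integrable
  have hs := hasSum_integral_geometric (v := fun t => v t * (r * (uc x)⁻¹ * uc t))
    (y := fun t => r * (uc x)⁻¹ * uc t) (ρ := r)
    (hi.mul_bdd (c := r) (by fun_prop) (ae_of_all _ fun t => by simp [norm_uc, abs_of_nonneg h0]))
    (by fun_prop) h1 (fun t => by simp [norm_uc, abs_of_nonneg h0])
  have hz : ∀ n : ℕ, ∫ t, v t * (r * (uc x)⁻¹ * uc t) * (r * (uc x)⁻¹ * uc t) ^ n ∂bMeasure = 0 := by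
    intro n
    have : ∀ t, v t * (r * (uc x)⁻¹ * uc t) * (r * (uc x)⁻¹ * uc t) ^ n =
        (v t * uc t ^ (n + 1)) * (r * (uc x)⁻¹) ^ (n + 1) := fun t => by
      rw [mul_assoc, ← pow_succ', mul_pow]; ring
    simp_rw [this]
    rw [integral_mul_const, hv.2 n, zero_mul]
  simp_rw [hz] at hs
  have h2 := hs.unique hasSum_zero
  unfold szProj
  rw [integral_eq_bMeasure]
  congr 1
  simp_rw [pk_eq_add h0 h1, mul_add]
  have hc1 : Continuous fun t => (1 - r * uc x * (uc t)⁻¹)⁻¹ := by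
    refine Continuous.inv₀ (by fun_prop) fun t ht => ?_
    have : ‖(r : ℂ) * uc x * (uc t)⁻¹‖ = 1 := by rw [← sub_eq_zero.1 ht]; simp
    simp [norm_uc, abs_of_nonneg h0] at this
    linarith
  have hc2 : Continuous fun t => r * (uc x)⁻¹ * uc t * (1 - r * (uc x)⁻¹ * uc t)⁻¹ := by
    refine Continuous.mul (by fun_prop) (Continuous.inv₀ (by fun_prop) fun t ht => ?_)
    have : ‖(r : ℂ) * (uc x)⁻¹ * uc t‖ = 1 := by rw [← sub_eq_zero.1 ht]; simp
    simp [norm_uc, abs_of_nonneg h0] at this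
    linarith
  have hbdd : ∀ F : ℝ → ℂ, Continuous F → Integrable (fun t => v t * F t) bMeasure := by
    intro F hF
    rw [← intervalIntegrable_iff_bMeasure]
    exact ((intervalIntegrable_iff_bMeasure v).2 hi).mul_continuousOn hF.continuousOn
  rw [integral_add (hbdd _ hc1) (hbdd _ hc2)]
  simp_rw [mul_assoc] at h2 ⊢
  rw [h2, add_zero]

/-- **Fatou's theorem** for Poisson integrals of complex integrable functions. -/
theorem ae_tendsto_poisson {v : ℝ → ℂ} (hv : Integrable v bMeasure) :
    ∀ᵐ x ∂bMeasure, Tendsto (fun r => ∫ t, v t * (pk r (t - x) : ℂ) ∂bMeasure)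
      (nhdsWithin 1 (Iio 1)) (nhds (2 * Real.pi * v x)) := by
  have h1 := ae_tendsto_poisson_real ((intervalIntegrable_iff_bMeasure _).2 hv.re)
  have h2 := ae_tendsto_poisson_real ((intervalIntegrable_iff_bMeasure _).2 hv.im)
  have hIoo : ∀ᵐ x ∂bMeasure, x ∈ Ioo 0 (2 * Real.pi) := by
    unfold bMeasure
    rw [← Measure.restrict_congr_set Ioo_ae_eq_Ioc]
    exact ae_restrict_mem measurableSet_Ioo
  filter_upwards [ae_restrict_of_ae h1, ae_restrict_of_ae h2, hIoo] with x hx1 hx2 hx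
  have k1 := (Complex.continuous_ofReal.tendsto _).comp (hx1 hx)
  have k2 := (Complex.continuous_ofReal.tendsto _).comp (hx2 hx)
  have k := k1.add (k2.mul_const Complex.I)
  have e : ((2 * Real.pi * RCLike.re (v x) : ℝ) : ℂ) + ((2 * Real.pi * RCLike.im (v x) : ℝ) : ℂ) *
      Complex.I = 2 * Real.pi * v x := by
    conv_rhs => rw [← Complex.re_add_im (v x)]
    simp only [RCLike.re_to_complex, RCLike.im_to_complex]
    push_cast; ring
  rw [e] at k
  refine k.congr' ?_
  filter_upwards [self_mem_nhdsWithin, nhdsWithin_le_nhds (Ioi_mem_nhds (zero_lt_one (α := ℝ)))]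
    with r hr1 hr0
  have hpk : Continuous fun t => pk r (t - x) :=
    (continuous_pk (le_of_lt hr0) hr1).comp (by fun_prop)
  have hInt : Integrable (fun t => v t * (pk r (t - x) : ℂ)) bMeasure := by
    rw [← intervalIntegrable_iff_bMeasure]
    exact ((intervalIntegrable_iff_bMeasure v).2 hv).mul_continuousOn
      (Complex.continuous_ofReal.comp hpk).continuousOn
  simp only [Function.comp_apply, integral_eq_bMeasure]
  have r1 : ∫ t, pk r (t - x) * RCLike.re (v t) ∂bMeasure =
      RCLike.re (∫ t, v t * (pk r (t - x) : ℂ) ∂bMeasure) := by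
    rw [← integral_re hInt]
    exact integral_congr_ae (ae_of_all _ fun t => by simp [mul_comm])
  have r2 : ∫ t, pk r (t - x) * RCLike.im (v t) ∂bMeasure =
      RCLike.im (∫ t, v t * (pk r (t - x) : ℂ) ∂bMeasure) := by
    rw [← integral_im hInt]
    exact integral_congr_ae (ae_of_all _ fun t => by simp [mul_comm])
  rw [r1, r2]
  exact Complex.re_add_im _

/-- Hardy boundary functions are the radial limits of their Szegő projections. -/
theorem IsHardyBdry.ae_tendsto_szProj {v : ℝ → ℂ} (hv : IsHardyBdry v) :
    ∀ᵐ x ∂bMeasure, Tendsto (fun r : ℝ => szProj v (r * uc x))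
      (nhdsWithin 1 (Iio 1)) (nhds (v x)) := by
  filter_upwards [ae_tendsto_poisson hv.integrable] with x hx
  have h := hx.const_mul (1 / (2 * (Real.pi : ℂ)))
  have e : 1 / (2 * (Real.pi : ℂ)) * (2 * Real.pi * v x) = v x := by
    have : (Real.pi : ℂ) ≠ 0 := Complex.ofReal_ne_zero.2 Real.pi_ne_zero
    field_simp
  rw [e] at h
  refine h.congr' ?_
  filter_upwards [self_mem_nhdsWithin, nhdsWithin_le_nhds (Ioi_mem_nhds (zero_lt_one (α := ℝ)))]
    with r hr1 hr0
  exact (szProj_eq_poisson hv (le_of_lt hr0) hr1 x).symm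

lemma bdry_eq_of_tendsto {F : ℂ → ℂ} {x : ℝ} {w : ℂ}
    (h : Tendsto (fun r : ℝ => F (r * uc x)) (nhdsWithin 1 (Iio 1)) (nhds w)) : bdry F x = w :=
  h.limUnder_eq

lemma hasFPowerSeriesOnBall_of_hasSum {c : ℕ → ℂ} {F : ℂ → ℂ}
    (h : ∀ z, ‖z‖ < 1 → HasSum (fun n => c n * z ^ n) (F z)) :
    HasFPowerSeriesOnBall F (fun n => ContinuousMultilinearMap.mkPiRing ℂ (Fin n) (c n)) 0 1 where
  r_le := by
    refine ENNReal.le_of_forall_nnreal_lt fun r hr => ?_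
    refine FormalMultilinearSeries.le_radius_of_summable_norm _ ?_
    have hr1 : (r : ℝ) < 1 := by exact_mod_cast hr
    have := (h (r : ℝ) (by simpa using hr1)).summable.norm
    simpa using this
  r_pos := one_pos
  hasSum := fun {y} hy => by
    have hy1 : ‖y‖ < 1 := by
      have hy' : ‖y‖ₑ < 1 := by simpa using hy
      rwa [← ofReal_norm, ENNReal.ofReal_lt_one] at hy'
    simpa [mul_comm] using h y hy1

lemma coeff_eq_of_hasSum {c d : ℕ → ℂ} {F : ℂ → ℂ}
    (hc : ∀ z, ‖z‖ < 1 → HasSum (fun n => c n * z ^ n) (F z))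
    (hd : ∀ z, ‖z‖ < 1 → HasSum (fun n => d n * z ^ n) (F z)) : c = d := by
  have h := (hasFPowerSeriesOnBall_of_hasSum hc).hasFPowerSeriesAt.eq_formalMultilinearSeries
    (hasFPowerSeriesOnBall_of_hasSum hd).hasFPowerSeriesAt
  funext n
  have := congrFun h n
  simpa using congrArg (fun m => m fun _ => 1) this

lemma differentiableOn_unitDisk_of_hasSum {c : ℕ → ℂ} {F : ℂ → ℂ}
    (h : ∀ z, ‖z‖ < 1 → HasSum (fun n => c n * z ^ n) (F z)) : DifferentiableOn ℂ F unitDisk := by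
  have := (hasFPowerSeriesOnBall_of_hasSum h).differentiableOn
  simpa [unitDisk, ← Metric.eball_ofReal] using this

lemma mem_unitDisk {z : ℂ} : z ∈ unitDisk ↔ ‖z‖ < 1 := by simp [unitDisk]

/-- The Szegő projection of `v` vanishes iff the Fourier coefficients of nonnegative index do. -/
lemma szProj_eq_zero_iff {v : ℝ → ℂ} (hv : Integrable v bMeasure) :
    (∀ z ∈ unitDisk, szProj v z = 0) ↔ ∀ n : ℕ, ∫ θ, v θ * ((uc θ)⁻¹) ^ n ∂bMeasure = 0 := by
  constructor
  · intro h n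
    have := coeff_eq_of_hasSum (F := szProj v) (d := 0) (fun z hz => hasSum_szProj hv hz)
      (fun z hz => by simp [h z (mem_unitDisk.2 hz), hasSum_zero])
    have := congrFun this n
    have hpi : (1 / (2 * (Real.pi : ℂ))) ≠ 0 := by simp [Real.pi_ne_zero]
    exact (mul_eq_zero.1 this).resolve_left hpi
  · intro h z hz
    have := hasSum_szProj hv (mem_unitDisk.1 hz)
    simp_rw [h, mul_zero, zero_mul] at this
    exact this.unique hasSum_zero

lemma integral_uc_zpow (k : ℤ) :
    ∫ θ, uc θ ^ k ∂bMeasure = if k = 0 then 2 * (Real.pi : ℂ) else 0 := by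
  rw [← integral_eq_bMeasure]
  split_ifs with hk
  · simp [hk]
  · have hc : (k * Complex.I : ℂ) ≠ 0 := by simp [hk]
    have e : ∀ θ : ℝ, uc θ ^ k = Complex.exp (k * Complex.I * θ) := fun θ => by
      unfold uc; rw [← Complex.exp_int_mul]; ring_nf
    simp_rw [e]
    rw [integral_exp_mul_complex hc]
    have : Complex.exp (k * Complex.I * ((2 * Real.pi : ℝ) : ℂ)) = 1 := by
      rw [← Complex.exp_int_mul_two_pi_mul_I k]; push_cast; ring_nf
    rw [this]; simp

/-- The normalized Fourier monomial of index `k`. -/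
def ucMonomial (k : ℤ) (θ : ℝ) : ℂ := ((√(2 * Real.pi))⁻¹ : ℝ) * uc θ ^ k

lemma continuous_ucMonomial (k : ℤ) : Continuous (ucMonomial k) := by
  unfold ucMonomial
  exact continuous_const.mul (continuous_uc.zpow₀ k fun θ => Or.inl (uc_ne_zero θ))

lemma Continuous.memLp_bMeasure {F : ℝ → ℂ} (hF : Continuous F) (p : ENNReal) :
    MemLp F p bMeasure := by
  obtain ⟨C, hC⟩ := isCompact_Icc.exists_bound_of_continuousOn
    (hF.continuousOn (s := Icc 0 (2 * Real.pi)))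
  refine MemLp.of_bound hF.aestronglyMeasurable C ?_
  unfold bMeasure
  filter_upwards [ae_restrict_mem measurableSet_Ioc] with θ hθ
  exact hC θ (Ioc_subset_Icc_self hθ)

/-- The normalized Fourier monomials as elements of `L²`. -/
def ucMonomialLp (k : ℤ) : Lp ℂ 2 bMeasure :=
  ((continuous_ucMonomial k).memLp_bMeasure 2).toLp _

lemma inner_toLp {u v : ℝ → ℂ} (hu : MemLp u 2 bMeasure) (hv : MemLp v 2 bMeasure) :
    inner ℂ (hu.toLp u) (hv.toLp v) = ∫ θ, v θ * (starRingEnd ℂ) (u θ) ∂bMeasure := by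
  rw [L2.inner_def]
  refine integral_congr_ae ?_
  filter_upwards [hu.coeFn_toLp, hv.coeFn_toLp] with θ h1 h2
  rw [h1, h2]
  simp

lemma conj_ucMonomial (k : ℤ) (θ : ℝ) :
    (starRingEnd ℂ) (ucMonomial k θ) = ((√(2 * Real.pi))⁻¹ : ℝ) * uc θ ^ (-k) := by
  simp [ucMonomial, conj_uc]

lemma inner_ucMonomialLp_toLp (k : ℤ) {v : ℝ → ℂ} (hv : MemLp v 2 bMeasure) :
    inner ℂ (ucMonomialLp k) (hv.toLp v) =
      ((√(2 * Real.pi))⁻¹ : ℝ) * ∫ θ, v θ * uc θ ^ (-k) ∂bMeasure := by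
  rw [ucMonomialLp, inner_toLp, ← integral_const_mul]
  congr 1
  ext θ
  rw [conj_ucMonomial]; ring

lemma inv_sqrt_two_pi_mul_self :
    (((√(2 * Real.pi))⁻¹ : ℝ) : ℂ) * ((√(2 * Real.pi))⁻¹ : ℝ) = 1 / (2 * Real.pi) := by
  rw [← Complex.ofReal_mul, ← mul_inv, Real.mul_self_sqrt (by positivity)]
  push_cast; simp

lemma orthonormal_ucMonomialLp : Orthonormal ℂ ucMonomialLp := by
  rw [orthonormal_iff_ite]
  intro j k
  rw [show ucMonomialLp k = ((continuous_ucMonomial k).memLp_bMeasure 2).toLp _ from rfl,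
    inner_ucMonomialLp_toLp]
  have e : ∀ θ, ucMonomial k θ * uc θ ^ (-j) = ((√(2 * Real.pi))⁻¹ : ℝ) * uc θ ^ (k - j) := by
    intro θ
    rw [ucMonomial, mul_assoc, ← zpow_add₀ (uc_ne_zero θ), sub_eq_add_neg]
  simp_rw [e]
  rw [integral_const_mul, integral_uc_zpow, ← mul_assoc, inv_sqrt_two_pi_mul_self]
  have hpi : (Real.pi : ℂ) ≠ 0 := Complex.ofReal_ne_zero.2 Real.pi_ne_zero
  by_cases h : j = k
  · subst h; simp; field_simp
  · rw [if_neg h, if_neg (by omega), mul_zero]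

lemma uc_pow_eq_zpow (n : ℕ) (θ : ℝ) : uc θ ^ (n + 1) = uc θ ^ (-(-(n + 1 : ℤ))) := by
  rw [neg_neg]; exact_mod_cast (zpow_natCast (uc θ) (n + 1)).symm

lemma uc_inv_pow_eq_zpow (n : ℕ) (θ : ℝ) : ((uc θ)⁻¹) ^ n = uc θ ^ (-(n : ℤ)) := by simp

lemma inv_sqrt_two_pi_ne_zero : (((√(2 * Real.pi))⁻¹ : ℝ) : ℂ) ≠ 0 := by
  have : 0 < √(2 * Real.pi) := by positivity
  exact Complex.ofReal_ne_zero.2 (inv_ne_zero this.ne')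

/-- Square integrable functions are determined by their Fourier coefficients. -/
lemma ae_eq_zero_of_integral_uc_zpow {v : ℝ → ℂ} (hv : MemLp v 2 bMeasure)
    (h : ∀ k : ℤ, ∫ θ, v θ * uc θ ^ k ∂bMeasure = 0) : v =ᵐ[bMeasure] 0 := by
  have hH : IsHardyBdry v := ⟨hv, fun n => by simp_rw [uc_pow_eq_zpow]; exact h _⟩
  have hz := (szProj_eq_zero_iff hH.integrable).2 fun n => by
    simp_rw [uc_inv_pow_eq_zpow]; exact h _
  filter_upwards [hH.ae_tendsto_szProj] with x hx
  refine tendsto_nhds_unique hx (tendsto_const_nhds.congr' ?_)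
  filter_upwards [self_mem_nhdsWithin, nhdsWithin_le_nhds (Ioi_mem_nhds (zero_lt_one (α := ℝ)))]
    with r hr1 hr0
  refine (hz _ (mem_unitDisk.2 ?_)).symm
  rw [norm_mul, norm_uc, mul_one, Complex.norm_real, Real.norm_of_nonneg (le_of_lt hr0)]
  exact hr1

/-- The Fourier basis of `L²` of the circle. -/
def ucBasis : HilbertBasis ℤ ℂ (Lp ℂ 2 bMeasure) :=
  HilbertBasis.mkOfOrthogonalEqBot orthonormal_ucMonomialLp <| by
    rw [Submodule.eq_bot_iff]
    intro V hV
    have hm : MemLp V 2 bMeasure := Lp.memLp V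
    have hz := ae_eq_zero_of_integral_uc_zpow hm fun k => by
      have h1 := (Submodule.mem_orthogonal _ _).1 hV (ucMonomialLp (-k))
        (Submodule.subset_span ⟨_, rfl⟩)
      have h2 := inner_ucMonomialLp_toLp (-k) hm
      rw [Lp.toLp_coeFn, h1, neg_neg] at h2
      exact (mul_eq_zero.1 h2.symm).resolve_left inv_sqrt_two_pi_ne_zero
    exact Lp.ext (hz.trans (Lp.coeFn_zero _ _ _).symm)

lemma coe_ucBasis : ⇑ucBasis = ucMonomialLp := HilbertBasis.coe_mkOfOrthogonalEqBot _ _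

lemma MemLp.conj_bMeasure {v : ℝ → ℂ} (hv : MemLp v 2 bMeasure) :
    MemLp (fun θ => (starRingEnd ℂ) (v θ)) 2 bMeasure :=
  hv.star

/-- The mean value over the circle is multiplicative on Hardy boundary functions. -/
lemma IsHardyBdry.integral_mul {u v : ℝ → ℂ} (hu : IsHardyBdry u) (hv : IsHardyBdry v) :
    ∫ θ, u θ * v θ ∂bMeasure =
      1 / (2 * (Real.pi : ℂ)) * ((∫ θ, u θ ∂bMeasure) * ∫ θ, v θ ∂bMeasure) := by
  have hc := MemLp.conj_bMeasure hu.1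
  have h := ucBasis.hasSum_inner_mul_inner (hc.toLp _) (hv.1.toLp _)
  have h1 : inner ℂ (hc.toLp _) (hv.1.toLp _) = ∫ θ, u θ * v θ ∂bMeasure := by
    rw [inner_toLp]
    simp [mul_comm]
  have h2 : ∀ k, inner ℂ (hc.toLp _) (ucBasis k) =
      ((√(2 * Real.pi))⁻¹ : ℝ) * ∫ θ, u θ * uc θ ^ k ∂bMeasure := fun k => by
    rw [coe_ucBasis, ucMonomialLp, inner_toLp, ← integral_const_mul]
    congr 1
    ext θ
    simp only [ucMonomial, Complex.conj_conj]; ring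
  rw [h1] at h
  have h3 := hasSum_single (f := fun k => inner ℂ (hc.toLp _) (ucBasis k) *
      inner ℂ (ucBasis k) (hv.1.toLp _)) 0 fun k hk => by
    rcases lt_or_gt_of_ne hk with hk | hk
    · obtain ⟨n, rfl⟩ : ∃ n : ℕ, k = -(n + 1 : ℤ) := ⟨(-k - 1).toNat, by omega⟩
      rw [coe_ucBasis, inner_ucMonomialLp_toLp]
      have := hv.2 n
      simp_rw [uc_pow_eq_zpow] at this
      rw [this, mul_zero, mul_zero]
    · obtain ⟨n, rfl⟩ : ∃ n : ℕ, k = -(-(n + 1 : ℤ)) := ⟨(k - 1).toNat, by omega⟩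
      have := hu.2 n
      simp_rw [uc_pow_eq_zpow] at this
      rw [h2, this, mul_zero, zero_mul]
  rw [h.unique h3, h2, coe_ucBasis, inner_ucMonomialLp_toLp, ← inv_sqrt_two_pi_mul_self]
  simp only [neg_zero, zpow_zero, mul_one]
  ring

lemma pk_sub_comm (r x t : ℝ) : pk r (t - x) = pk r (x - t) := by
  rw [← neg_sub x t, pk, pk, Real.cos_neg]

lemma mul_uc_mem_unitDisk {r : ℝ} (h0 : 0 ≤ r) (h1 : r < 1) (x : ℝ) : r * uc x ∈ unitDisk := by
  rw [mem_unitDisk, norm_mul, norm_uc, mul_one, Complex.norm_real, Real.norm_of_nonneg h0]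
  exact h1

lemma continuous_comp_mul_uc {F : ℂ → ℂ} (hF : DifferentiableOn ℂ F unitDisk) {r : ℝ}
    (h0 : 0 ≤ r) (h1 : r < 1) : Continuous fun x => F (r * uc x) :=
  hF.continuousOn.comp_continuous (by fun_prop) (mul_uc_mem_unitDisk h0 h1)

lemma IsHardyBdry.differentiableOn_szProj {v : ℝ → ℂ} (hv : IsHardyBdry v) :
    DifferentiableOn ℂ (szProj v) unitDisk :=
  differentiableOn_unitDisk_of_hasSum fun _ hz => hasSum_szProj hv.integrable hz

lemma MemLp.integrable_norm_sq {v : ℝ → ℂ} (hv : MemLp v 2 bMeasure) :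
    Integrable (fun t => ‖v t‖ ^ 2) bMeasure := hv.integrable_norm_pow (by norm_num)

lemma Integrable.mul_continuous_bMeasure {𝕜 : Type*} [RCLike 𝕜] {v F : ℝ → 𝕜}
    (hv : Integrable v bMeasure) (hF : Continuous F) : Integrable (fun t => v t * F t) bMeasure := by
  rw [← intervalIntegrable_iff_bMeasure]
  exact ((intervalIntegrable_iff_bMeasure v).2 hv).mul_continuousOn hF.continuousOn

/-- Square means of the Szegő projection are controlled by the Poisson integral of the square. -/
lemma IsHardyBdry.norm_szProj_sq_le {v : ℝ → ℂ} (hv : IsHardyBdry v) {r : ℝ} (h0 : 0 ≤ r)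
    (h1 : r < 1) (x : ℝ) :
    2 * Real.pi * ‖szProj v (r * uc x)‖ ^ 2 ≤ ∫ t, ‖v t‖ ^ 2 * pk r (t - x) ∂bMeasure := by
  set K := szProj v (r * uc x) with hK
  have hpk : Continuous fun t => pk r (t - x) := (continuous_pk h0 h1).comp (by fun_prop)
  have hpi : (Real.pi : ℂ) ≠ 0 := Complex.ofReal_ne_zero.2 Real.pi_ne_zero
  have hP : ∫ t, v t * (pk r (t - x) : ℂ) ∂bMeasure = 2 * Real.pi * K := by
    rw [hK, szProj_eq_poisson hv h0 h1]; field_simp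
  have hone : ∫ t, pk r (t - x) ∂bMeasure = 2 * Real.pi := by
    rw [← integral_eq_bMeasure]; exact integral_pk h0 h1 x
  have i1 : Integrable (fun t => ‖v t‖ ^ 2 * pk r (t - x)) bMeasure :=
    Integrable.mul_continuous_bMeasure (MemLp.integrable_norm_sq hv.1) hpk
  have i2 : Integrable (fun t => v t * (pk r (t - x) : ℂ)) bMeasure :=
    Integrable.mul_continuous_bMeasure hv.integrable (Complex.continuous_ofReal.comp hpk)
  have i3 : Integrable (fun t => ((starRingEnd ℂ) K * (v t * (pk r (t - x) : ℂ))).re) bMeasure :=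
    (i2.const_mul _).re
  have i4 : Integrable (fun t => ‖v t‖ ^ 2 * pk r (t - x) -
      2 * ((starRingEnd ℂ) K * (v t * (pk r (t - x) : ℂ))).re) bMeasure := i1.sub (i3.const_mul 2)
  have e : ∀ t, ‖v t - K‖ ^ 2 * pk r (t - x) = ‖v t‖ ^ 2 * pk r (t - x) -
      2 * ((starRingEnd ℂ) K * (v t * (pk r (t - x) : ℂ))).re + ‖K‖ ^ 2 * pk r (t - x) := by
    intro t
    rw [← Complex.normSq_eq_norm_sq, ← Complex.normSq_eq_norm_sq, ← Complex.normSq_eq_norm_sq,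
      Complex.normSq_sub]
    simp only [Complex.mul_re, Complex.mul_im, Complex.conj_re, Complex.conj_im,
      Complex.ofReal_re, Complex.ofReal_im]
    ring
  have hnn : 0 ≤ ∫ t, ‖v t - K‖ ^ 2 * pk r (t - x) ∂bMeasure :=
    integral_nonneg fun t => mul_nonneg (by positivity) (pk_nonneg h0 h1 _)
  simp_rw [e] at hnn
  rw [integral_add i4 (hpk.integrable_bMeasure.const_mul _),
    integral_sub i1 (i3.const_mul 2), integral_const_mul, integral_const_mul, hone] at hnn
  have hre : ∫ t, ((starRingEnd ℂ) K * (v t * (pk r (t - x) : ℂ))).re ∂bMeasure =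
      2 * Real.pi * ‖K‖ ^ 2 := by
    have := integral_re (i2.const_mul ((starRingEnd ℂ) K))
    simp only [RCLike.re_to_complex] at this
    rw [this, integral_const_mul, hP, ← Complex.normSq_eq_norm_sq,
      show (starRingEnd ℂ) K * (2 * Real.pi * K) = ((2 * Real.pi : ℝ) : ℂ) * (K * (starRingEnd ℂ) K)
        by push_cast; ring, Complex.mul_conj, ← Complex.ofReal_mul, Complex.ofReal_re]
  rw [hre] at hnn
  linarith

lemma IsHardyBdry.integral_norm_szProj_sq_le {v : ℝ → ℂ} (hv : IsHardyBdry v) {r : ℝ} (h0 : 0 ≤ r)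
    (h1 : r < 1) :
    ∫ x, ‖szProj v (r * uc x)‖ ^ 2 ∂bMeasure ≤ ∫ t, ‖v t‖ ^ 2 ∂bMeasure := by
  have hv2 := MemLp.integrable_norm_sq hv.1
  obtain ⟨C, hC⟩ : ∃ C, ∀ s, ‖pk r s‖ ≤ C := by
    obtain ⟨C, hC⟩ := isCompact_Icc.exists_bound_of_continuousOn
      ((continuous_pk h0 h1).continuousOn (s := Icc 0 (2 * Real.pi)))
    refine ⟨C, fun s => ?_⟩
    obtain ⟨y, hy, e⟩ := (periodic_pk r).exists_mem_Ico₀ (by positivity) s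
    rw [e]; exact hC y (Ico_subset_Icc_self hy)
  have hInt : Integrable (Function.uncurry fun x t => ‖v t‖ ^ 2 * pk r (t - x))
      (bMeasure.prod bMeasure) := by
    have hpk : Continuous fun z : ℝ × ℝ => pk r (z.2 - z.1) :=
      (continuous_pk h0 h1).comp (by fun_prop)
    have := ((integrable_const (1 : ℝ)).mul_prod (μ := bMeasure) hv2).mul_bdd (c := C)
      hpk.aestronglyMeasurable (ae_of_all _ fun z => hC _)
    simpa [Function.uncurry_def] using this
  have hsw := integral_integral_swap hInt
  have hone : ∀ t, ∫ x, ‖v t‖ ^ 2 * pk r (t - x) ∂bMeasure = ‖v t‖ ^ 2 * (2 * Real.pi) := fun t => by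
    rw [integral_const_mul]
    simp_rw [pk_sub_comm r _ t]
    rw [← integral_eq_bMeasure, integral_pk h0 h1]
  simp_rw [hone] at hsw
  rw [integral_mul_const] at hsw
  have hc := continuous_comp_mul_uc hv.differentiableOn_szProj h0 h1
  have hle : ∫ x, 2 * Real.pi * ‖szProj v (r * uc x)‖ ^ 2 ∂bMeasure ≤
      ∫ x, ∫ t, ‖v t‖ ^ 2 * pk r (t - x) ∂bMeasure ∂bMeasure :=
    integral_mono ((hc.norm.pow 2).integrable_bMeasure.const_mul _) hInt.integral_prod_left
      fun x => hv.norm_szProj_sq_le h0 h1 x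
  rw [hsw, integral_const_mul, mul_comm] at hle
  exact le_of_mul_le_mul_right hle (by positivity)

theorem IsHardyBdry.memH2_szProj {v : ℝ → ℂ} (hv : IsHardyBdry v) : MemH2 (szProj v) :=
  ⟨hv.differentiableOn_szProj, _, fun r hr => by
    rw [integral_eq_bMeasure]; exact hv.integral_norm_szProj_sq_le hr.1 hr.2⟩

/-- Fourier coefficients of a power series restricted to a circle. -/
lemma integral_hasSum_mul_uc_zpow {c : ℕ → ℂ} {F : ℂ → ℂ}
    (h : ∀ z, ‖z‖ < 1 → HasSum (fun n => c n * z ^ n) (F z)) {r : ℝ} (h0 : 0 ≤ r) (h1 : r < 1)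
    (m : ℕ) : ∫ x, F (r * uc x) * uc x ^ (-(m : ℤ)) ∂bMeasure = 2 * Real.pi * (c m * r ^ m) := by
  have hr : ‖(r : ℂ)‖ < 1 := by rwa [Complex.norm_real, Real.norm_of_nonneg h0]
  have hcont : ∀ k : ℤ, Continuous fun x => uc x ^ k := fun k =>
    continuous_uc.zpow₀ k fun θ => Or.inl (uc_ne_zero θ)
  have hs := hasSum_integral_of_summable_integral_norm (E := ℂ) (μ := bMeasure)
    (F := fun (n : ℕ) x => c n * r ^ n * uc x ^ ((n : ℤ) - m))
    (fun n => ((hcont _).const_mul _).integrable_bMeasure) (by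
      simp only [norm_mul, norm_zpow, norm_uc, one_zpow, mul_one, integral_const, smul_eq_mul]
      simpa using (h r hr).summable.norm.mul_left _)
  have e1 : ∀ x, ∑' n : ℕ, c n * r ^ n * uc x ^ ((n : ℤ) - m) =
      F (r * uc x) * uc x ^ (-(m : ℤ)) := fun x => by
    rw [← (h _ (mem_unitDisk.1 (mul_uc_mem_unitDisk h0 h1 x))).tsum_eq, ← tsum_mul_right]
    refine tsum_congr fun n => ?_
    rw [sub_eq_add_neg, zpow_add₀ (uc_ne_zero x), mul_pow, zpow_natCast]; ring
  simp_rw [e1] at hs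
  refine hs.unique ?_
  have e2 : ∀ n : ℕ, ∫ x, c n * r ^ n * uc x ^ ((n : ℤ) - m) ∂bMeasure =
      if n = m then 2 * Real.pi * (c m * r ^ m) else 0 := fun n => by
    rw [integral_const_mul, integral_uc_zpow]
    by_cases hn : n = m
    · subst hn; simp; ring
    · rw [if_neg (by omega), if_neg hn, mul_zero]
  simp_rw [e2]
  exact hasSum_ite_eq m _

lemma norm_toLp_sq {v : ℝ → ℂ} (hv : MemLp v 2 bMeasure) :
    ‖hv.toLp v‖ ^ 2 = ∫ x, ‖v x‖ ^ 2 ∂bMeasure := by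
  rw [← inner_self_eq_norm_sq (𝕜 := ℂ), inner_toLp]
  simp_rw [Complex.mul_conj, Complex.normSq_eq_norm_sq]
  rw [integral_complex_ofReal]
  exact Complex.ofReal_re _

lemma norm_inv_sqrt_two_pi_sq : ‖(((√(2 * Real.pi))⁻¹ : ℝ) : ℂ)‖ ^ 2 = 1 / (2 * Real.pi) := by
  rw [Complex.norm_real, Real.norm_eq_abs, sq_abs, inv_pow, Real.sq_sqrt (by positivity)]
  simp

/-- The Taylor coefficients of an `H²` function are square summable. -/
lemma summable_norm_sq_of_memH2 {c : ℕ → ℂ} {F : ℂ → ℂ} (hF : MemH2 F)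
    (h : ∀ z, ‖z‖ < 1 → HasSum (fun n => c n * z ^ n) (F z)) :
    Summable fun n => ‖c n‖ ^ 2 := by
  obtain ⟨hd, C, hC⟩ := hF
  have key : ∀ (N : ℕ) (r : ℝ), r ∈ Ico (0 : ℝ) 1 →
      ∑ n ∈ Finset.range N, 2 * Real.pi * (‖c n‖ ^ 2 * (r ^ n) ^ 2) ≤ C := by
    intro N r hr
    have hm := (continuous_comp_mul_uc hd hr.1 hr.2).memLp_bMeasure 2
    have hb := (orthonormal_ucMonomialLp.comp (fun n : ℕ => (n : ℤ))
      Nat.cast_injective).sum_inner_products_le (hm.toLp _) (s := Finset.range N)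
    rw [norm_toLp_sq, ← integral_eq_bMeasure] at hb
    refine le_trans (le_of_eq (Finset.sum_congr rfl fun n _ => ?_)) (hb.trans (hC r hr))
    simp only [Function.comp_apply]
    rw [inner_ucMonomialLp_toLp, integral_hasSum_mul_uc_zpow h hr.1 hr.2, norm_mul, mul_pow,
      norm_inv_sqrt_two_pi_sq]
    simp only [norm_mul, norm_pow, Complex.norm_real, Real.norm_eq_abs, abs_of_nonneg hr.1,
      abs_of_pos Real.pi_pos, Complex.norm_ofNat]
    have := Real.pi_pos
    field_simp
  refine summable_of_sum_range_le (c := C / (2 * Real.pi)) (fun n => by positivity) fun N => ?_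
  have hlim : Tendsto (fun r : ℝ => ∑ n ∈ Finset.range N, 2 * Real.pi * (‖c n‖ ^ 2 * (r ^ n) ^ 2))
      (nhdsWithin 1 (Iio 1))
      (nhds (∑ n ∈ Finset.range N, 2 * Real.pi * (‖c n‖ ^ 2 * (1 ^ n) ^ 2))) := by
    refine Tendsto.mono_left (Continuous.tendsto ?_ 1) nhdsWithin_le_nhds
    fun_prop
  have := le_of_tendsto hlim (by
    filter_upwards [self_mem_nhdsWithin, nhdsWithin_le_nhds (Ioi_mem_nhds (zero_lt_one (α := ℝ)))]
      with r hr1 hr0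
    exact key N r ⟨le_of_lt hr0, hr1⟩)
  simp only [one_pow, mul_one, ← Finset.mul_sum] at this
  rw [le_div_iff₀ (by positivity)]
  linarith

/-- **Riesz–Fischer** for Hardy boundary functions. -/
lemma exists_isHardyBdry_of_summable {c : ℕ → ℂ} (hsum : Summable fun n => ‖c n‖ ^ 2) :
    ∃ v, IsHardyBdry v ∧
      ∀ n : ℕ, 1 / (2 * (Real.pi : ℂ)) * ∫ θ, v θ * ((uc θ)⁻¹) ^ n ∂bMeasure = c n := by
  obtain ⟨s, hs⟩ : ∃ s : ℂ, s = (((√(2 * Real.pi))⁻¹ : ℝ) : ℂ) := ⟨_, rfl⟩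
  have hs0 : s ≠ 0 := hs ▸ inv_sqrt_two_pi_ne_zero
  have hss : s * s = 1 / (2 * Real.pi) := hs ▸ inv_sqrt_two_pi_mul_self
  obtain ⟨d, hd1, hd2⟩ : ∃ d : ℤ → ℂ, (∀ n : ℕ, d n = s⁻¹ * c n) ∧ ∀ k < 0, d k = 0 :=
    ⟨fun k => if 0 ≤ k then s⁻¹ * c k.toNat else 0, fun n => by simp,
      fun k hk => if_neg (not_le.2 hk)⟩
  have hd : Memℓp d 2 := by
    refine memℓp_gen ?_
    simp only [ENNReal.toReal_ofNat, Real.rpow_two]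
    have hsupp : ∀ k : ℤ, k ∉ range (fun n : ℕ => (n : ℤ)) → ‖d k‖ ^ 2 = 0 := fun k hk => by
      have : k < 0 := by
        by_contra h
        exact hk ⟨k.toNat, Int.toNat_of_nonneg (not_lt.1 h)⟩
      simp [hd2 k this]
    refine (Function.Injective.summable_iff Nat.cast_injective hsupp).1 ?_
    have e : ((fun k : ℤ => ‖d k‖ ^ 2) ∘ fun n : ℕ => (n : ℤ)) = fun n => ‖s⁻¹‖ ^ 2 * ‖c n‖ ^ 2 := by
      funext n
      rw [Function.comp_apply, hd1, norm_mul, mul_pow]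
    rw [e]
    exact hsum.mul_left _
  obtain ⟨V, hV⟩ : ∃ V, V = ucBasis.repr.symm ⟨d, hd⟩ := ⟨_, rfl⟩
  have hm : MemLp V 2 bMeasure := Lp.memLp V
  have hco : ∀ k : ℤ, s * ∫ θ, V θ * uc θ ^ (-k) ∂bMeasure = d k := fun k => by
    rw [hs, ← inner_ucMonomialLp_toLp k hm, Lp.toLp_coeFn, ← coe_ucBasis,
      ← HilbertBasis.repr_apply_apply, hV, LinearIsometryEquiv.apply_symm_apply]
  refine ⟨V, ⟨hm, fun n => ?_⟩, fun n => ?_⟩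
  · simp_rw [uc_pow_eq_zpow]
    have h := hco (-(n + 1 : ℤ))
    rw [hd2 _ (by omega)] at h
    exact (mul_eq_zero.1 h).resolve_left hs0
  · simp_rw [uc_inv_pow_eq_zpow]
    rw [← hss, mul_assoc, hco, hd1, ← mul_assoc, mul_inv_cancel₀ hs0, one_mul]

/-- Every `H²` function is the Szegő projection of a Hardy boundary function. -/
theorem exists_isHardyBdry_of_memH2 {F : ℂ → ℂ} (hF : MemH2 F) :
    ∃ v, IsHardyBdry v ∧ ∀ z ∈ unitDisk, F z = szProj v z := by
  obtain ⟨c, hc⟩ : ∃ c : ℕ → ℂ, ∀ z, ‖z‖ < 1 → HasSum (fun n => c n * z ^ n) (F z) := by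
    refine ⟨fun n => (n.factorial : ℂ)⁻¹ * iteratedDeriv n F 0, fun z hz => ?_⟩
    have := Complex.hasSum_taylorSeries_on_ball hF.1 (mem_unitDisk.2 hz)
    simp only [sub_zero, smul_eq_mul] at this
    have e : ∀ n : ℕ, (n.factorial : ℂ)⁻¹ * iteratedDeriv n F 0 * z ^ n =
        (n.factorial : ℂ)⁻¹ * (z ^ n * iteratedDeriv n F 0) := fun n => by ring
    simp_rw [e]
    exact this
  obtain ⟨V, hV, hVc⟩ := exists_isHardyBdry_of_summable (summable_norm_sq_of_memH2 hF hc)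
  refine ⟨V, hV, fun z hz => (hc z (mem_unitDisk.1 hz)).unique ?_⟩
  simp_rw [← hVc]
  exact hasSum_szProj hV.integrable (mem_unitDisk.1 hz)

/-- Summary of the boundary behaviour of `H²` functions. -/
theorem MemH2.isHardyBdry_bdry {F : ℂ → ℂ} (hF : MemH2 F) :
    IsHardyBdry (bdry F) ∧ (∀ z ∈ unitDisk, F z = szProj (bdry F) z) ∧
      ∀ᵐ x ∂bMeasure, Tendsto (fun r : ℝ => F (r * uc x))
        (nhdsWithin 1 (Iio 1)) (nhds (bdry F x)) := by
  obtain ⟨v, hv, hFv⟩ := exists_isHardyBdry_of_memH2 hF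
  have hlim : ∀ᵐ x ∂bMeasure, Tendsto (fun r : ℝ => F (r * uc x))
      (nhdsWithin 1 (Iio 1)) (nhds (v x)) := by
    filter_upwards [hv.ae_tendsto_szProj] with x hx
    refine hx.congr' ?_
    filter_upwards [self_mem_nhdsWithin, nhdsWithin_le_nhds (Ioi_mem_nhds (zero_lt_one (α := ℝ)))]
      with r hr1 hr0
    exact (hFv _ (mul_uc_mem_unitDisk (le_of_lt hr0) hr1 x)).symm
  have hae : bdry F =ᵐ[bMeasure] v := hlim.mono fun x hx => bdry_eq_of_tendsto hx
  refine ⟨⟨hv.1.ae_eq hae.symm, fun n => ?_⟩, fun z hz => ?_, ?_⟩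
  · rw [← hv.2 n]
    exact integral_congr_ae (hae.mono fun x hx => by simp only [hx])
  · rw [hFv z hz, szProj_congr_ae hae]
  · filter_upwards [hlim, hae] with x h1 h2
    rwa [h2]

lemma circleMap_zero_eq (r x : ℝ) : circleMap 0 r x = r * uc x := by
  simp [circleMap, uc]

/-- **Jensen's inequality** on circles inside the disk. -/
lemma log_norm_le_integral_log_norm {F : ℂ → ℂ} (hd : DifferentiableOn ℂ F unitDisk) (h0 : F 0 ≠ 0)
    {r : ℝ} (hr0 : 0 < r) (hr1 : r < 1) :
    Integrable (fun x => Real.log ‖F (r * uc x)‖) bMeasure ∧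
      (∀ᵐ x ∂bMeasure, F (r * uc x) ≠ 0) ∧
      2 * Real.pi * Real.log ‖F 0‖ ≤ ∫ x, Real.log ‖F (r * uc x)‖ ∂bMeasure := by
  have ha : AnalyticOnNhd ℂ F unitDisk := hd.analyticOnNhd Metric.isOpen_ball
  have habs : |r| = r := abs_of_pos hr0
  have hsub : Metric.closedBall (0 : ℂ) |r| ⊆ unitDisk := by
    rw [habs]; exact Metric.closedBall_subset_ball hr1
  have hcb := ha.mono hsub
  refine ⟨?_, ?_, ?_⟩
  · have hm : MeromorphicOn F (Metric.sphere 0 |r|) := fun z hz =>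
      (hcb z (Metric.sphere_subset_closedBall hz)).meromorphicAt
    have := hm.circleIntegrable_log_norm
    unfold CircleIntegrable at this
    rw [intervalIntegrable_iff_bMeasure] at this
    simpa only [circleMap_zero_eq] using this
  · have hconn : IsPreconnected unitDisk := (convex_ball (0 : ℂ) 1).isPreconnected
    rcases ha.eqOn_zero_or_eventually_ne_zero_of_preconnected hconn with h | h
    · exact absurd (h (mem_unitDisk.2 (by simp))) h0
    · have h1 := codiscreteWithin_mono (Metric.sphere_subset_closedBall.trans hsub) h
      have h2 := circleMap_preimage_codiscrete hr0.ne' h1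
      have h3 := ae_restrict_le_codiscreteWithin (μ := volume)
        (U := Ioc 0 (2 * Real.pi)) measurableSet_Ioc
        (codiscreteWithin_mono (subset_univ _) h2)
      filter_upwards [show ∀ᵐ x ∂bMeasure, _ from h3] with x hx
      simpa [circleMap_zero_eq] using hx
  · have hJ := hcb.circleAverage_log_norm hr0.ne' h0
    rw [Real.circleAverage_def, integral_eq_bMeasure] at hJ
    simp only [circleMap_zero_eq] at hJ
    have hnn : 0 ≤ ∑ᶠ u : ℂ, ((MeromorphicOn.divisor F (Metric.closedBall 0 |r|) u : ℤ) : ℝ) *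
        Real.log (r * ‖0 - u‖⁻¹) := by
      refine finsum_nonneg fun u => ?_
      by_cases hu : u ∈ Metric.closedBall (0 : ℂ) |r|
      · refine mul_nonneg (by exact_mod_cast MeromorphicOn.AnalyticOnNhd.divisor_nonneg hcb u) ?_
        rcases eq_or_ne u 0 with rfl | hu0
        · simp
        · refine Real.log_nonneg ?_
          have : 0 < ‖u‖ := norm_pos_iff.2 hu0
          rw [zero_sub, norm_neg, ← div_eq_mul_inv, one_le_div this]
          simpa [habs] using hu
      · rw [Function.locallyFinsuppWithin.apply_eq_zero_of_notMem _ hu]; simp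
    have hle : Real.log ‖F 0‖ ≤ (2 * Real.pi)⁻¹ * ∫ x, Real.log ‖F (r * uc x)‖ ∂bMeasure := by
      rw [smul_eq_mul] at hJ
      rw [hJ]; linarith
    rw [← div_eq_inv_mul, le_div_iff₀ (by positivity)] at hle
    linarith

/-- The function `y ↦ y² - log y`, with the value `∞` at zero. -/
def sqSubLog (y : ℝ) : ENNReal := if y = 0 then ⊤ else ENNReal.ofReal (y ^ 2 - Real.log y)

lemma measurable_sqSubLog : Measurable sqSubLog := by
  unfold sqSubLog
  refine Measurable.ite (measurableSet_singleton 0) measurable_const ?_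
  exact ((measurable_id.pow_const 2).sub Real.measurable_log).ennreal_ofReal

lemma continuous_sqSubLog : Continuous sqSubLog := by
  rw [continuous_iff_continuousAt]
  intro y
  rcases eq_or_ne y 0 with rfl | hy
  · have h0 : sqSubLog 0 = ⊤ := if_pos rfl
    rw [ContinuousAt, h0, ENNReal.tendsto_nhds_top_iff_nnreal]
    intro c
    have hlog : ∀ᶠ y in nhdsWithin (0 : ℝ) {0}ᶜ, Real.log y < -(c : ℝ) :=
      Real.tendsto_log_nhdsNE_zero.eventually_lt_atBot _
    rw [eventually_nhdsWithin_iff] at hlog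
    filter_upwards [hlog] with y hy
    unfold sqSubLog
    split_ifs with h
    · exact ENNReal.coe_lt_top
    · have := hy h
      rw [← ENNReal.ofReal_coe_nnreal, ENNReal.ofReal_lt_ofReal_iff_of_nonneg c.coe_nonneg]
      nlinarith [sq_nonneg y]
  · have hc : ContinuousAt (fun y : ℝ => ENNReal.ofReal (y ^ 2 - Real.log y)) y :=
      ENNReal.continuous_ofReal.continuousAt.comp
        ((continuousAt_id.pow 2).sub (Real.continuousAt_log hy))
    refine hc.congr ?_
    filter_upwards [isOpen_ne.mem_nhds hy] with t ht
    exact (if_neg ht).symm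

lemma log_le_sq {y : ℝ} (hy : 0 ≤ y) : Real.log y ≤ y ^ 2 := by
  rcases hy.eq_or_lt with rfl | h
  · simp
  · nlinarith [Real.log_le_sub_one_of_pos h, sq_nonneg (y - 1)]

/-- **Jensen's inequality** on the boundary: the logarithm of a Hardy boundary function whose
analytic extension does not vanish at the origin is integrable. -/
theorem IsHardyBdry.jensen {v : ℝ → ℂ} (hv : IsHardyBdry v) (h0 : szProj v 0 ≠ 0) :
    (∀ᵐ x ∂bMeasure, v x ≠ 0) ∧ Integrable (fun x => Real.log ‖v x‖) bMeasure ∧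
      2 * Real.pi * Real.log ‖szProj v 0‖ ≤ ∫ x, Real.log ‖v x‖ ∂bMeasure := by
  have hd := hv.differentiableOn_szProj
  obtain ⟨r, hr0, hr1, hrt⟩ : ∃ r : ℕ → ℝ, (∀ n, 0 < r n) ∧ (∀ n, r n < 1) ∧
      Tendsto r atTop (nhdsWithin 1 (Iio 1)) := by
    obtain ⟨r, -, h2, h3⟩ := exists_seq_strictMono_tendsto' (zero_lt_one (α := ℝ))
    exact ⟨r, fun n => (h2 n).1, fun n => (h2 n).2,
      tendsto_nhdsWithin_iff.2 ⟨h3, Eventually.of_forall fun n => (h2 n).2⟩⟩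
  obtain ⟨M, hM⟩ : ∃ M, M = ∫ t, ‖v t‖ ^ 2 ∂bMeasure := ⟨_, rfl⟩
  obtain ⟨L, hL⟩ : ∃ L, L = 2 * Real.pi * Real.log ‖szProj v 0‖ := ⟨_, rfl⟩
  have hv2 := MemLp.integrable_norm_sq hv.1
  have hn : ∀ n, ∫⁻ x, sqSubLog ‖szProj v (r n * uc x)‖ ∂bMeasure ≤ ENNReal.ofReal (M - L) := by
    intro n
    obtain ⟨h1, h2, h3⟩ := log_norm_le_integral_log_norm hd h0 (hr0 n) (hr1 n)
    have hc := continuous_comp_mul_uc hd (hr0 n).le (hr1 n)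
    have h4 : Integrable (fun x => ‖szProj v (r n * uc x)‖ ^ 2) bMeasure :=
      (hc.norm.pow 2).integrable_bMeasure
    have e : ∫⁻ x, sqSubLog ‖szProj v (r n * uc x)‖ ∂bMeasure = ∫⁻ x, ENNReal.ofReal
        (‖szProj v (r n * uc x)‖ ^ 2 - Real.log ‖szProj v (r n * uc x)‖) ∂bMeasure :=
      lintegral_congr_ae (h2.mono fun x hx => if_neg (norm_ne_zero_iff.2 hx))
    have h5 : Integrable (fun x => ‖szProj v (r n * uc x)‖ ^ 2 -
      Real.log ‖szProj v (r n * uc x)‖) bMeasure := h4.sub h1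
    rw [e, ← ofReal_integral_eq_lintegral_ofReal h5
      (ae_of_all _ fun x => sub_nonneg.2 (log_le_sq (norm_nonneg _)))]
    refine ENNReal.ofReal_le_ofReal ?_
    rw [integral_sub h4 h1]
    have := hv.integral_norm_szProj_sq_le (hr0 n).le (hr1 n)
    linarith
  have hF : ∫⁻ x, sqSubLog ‖v x‖ ∂bMeasure ≤ ENNReal.ofReal (M - L) := by
    calc ∫⁻ x, sqSubLog ‖v x‖ ∂bMeasure
        = ∫⁻ x, liminf (fun n => sqSubLog ‖szProj v (r n * uc x)‖) atTop ∂bMeasure := by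
          refine lintegral_congr_ae ?_
          filter_upwards [hv.ae_tendsto_szProj] with x hx
          exact ((continuous_sqSubLog.tendsto _).comp (hx.comp hrt).norm).liminf_eq.symm
      _ ≤ liminf (fun n => ∫⁻ x, sqSubLog ‖szProj v (r n * uc x)‖ ∂bMeasure) atTop :=
          lintegral_liminf_le fun n => measurable_sqSubLog.comp
            (continuous_comp_mul_uc hd (hr0 n).le (hr1 n)).norm.measurable
      _ ≤ ENNReal.ofReal (M - L) :=
          liminf_le_of_frequently_le' (Frequently.of_forall hn)
  have hmeas : AEMeasurable (fun x => ‖v x‖) bMeasure := hv.1.aestronglyMeasurable.norm.aemeasurable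
  have hne : ∀ᵐ x ∂bMeasure, v x ≠ 0 := by
    filter_upwards [ae_lt_top' (measurable_sqSubLog.comp_aemeasurable hmeas)
      (hF.trans_lt ENNReal.ofReal_lt_top).ne] with x hx h
    rw [Function.comp_apply, h, norm_zero, sqSubLog, if_pos rfl] at hx
    exact lt_irrefl _ hx
  have hlogm : AEStronglyMeasurable (fun x => Real.log ‖v x‖) bMeasure :=
    (Real.measurable_log.comp_aemeasurable hmeas).aestronglyMeasurable
  have hnn : 0 ≤ᵐ[bMeasure] fun x => ‖v x‖ ^ 2 - Real.log ‖v x‖ :=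
    ae_of_all _ fun x => sub_nonneg.2 (log_le_sq (norm_nonneg _))
  have e : ∫⁻ x, sqSubLog ‖v x‖ ∂bMeasure =
      ∫⁻ x, ENNReal.ofReal (‖v x‖ ^ 2 - Real.log ‖v x‖) ∂bMeasure :=
    lintegral_congr_ae (hne.mono fun x hx => if_neg (norm_ne_zero_iff.2 hx))
  rw [e] at hF
  have hInt : Integrable (fun x => ‖v x‖ ^ 2 - Real.log ‖v x‖) bMeasure :=
    (lintegral_ofReal_ne_top_iff_integrable (hv2.aestronglyMeasurable.sub hlogm) hnn).1
      (hF.trans_lt ENNReal.ofReal_lt_top).ne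
  have hlog : Integrable (fun x => Real.log ‖v x‖) bMeasure :=
    (hv2.sub hInt).congr (ae_of_all _ fun x => by simp)
  refine ⟨hne, hlog, ?_⟩
  rw [← ofReal_integral_eq_lintegral_ofReal hInt hnn, integral_sub hv2 hlog, ← hM] at hF
  have hML : 0 ≤ M - L := by
    obtain ⟨-, -, h3⟩ := log_norm_le_integral_log_norm hd h0 (hr0 0) (hr1 0)
    have hc := continuous_comp_mul_uc hd (hr0 0).le (hr1 0)
    have h4 : Integrable (fun x => ‖szProj v (r 0 * uc x)‖ ^ 2) bMeasure :=
      (hc.norm.pow 2).integrable_bMeasure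
    obtain ⟨h1, -, -⟩ := log_norm_le_integral_log_norm hd h0 (hr0 0) (hr1 0)
    have h5 := hv.integral_norm_szProj_sq_le (hr0 0).le (hr1 0)
    have h6 := integral_mono h1 h4 fun x => log_le_sq (norm_nonneg _)
    linarith
  have := (ENNReal.ofReal_le_ofReal_iff hML).1 hF
  linarith

lemma mul_conj_eq_one {w : ℂ} (hw : ‖w‖ = 1) : w * (starRingEnd ℂ) w = 1 := by
  rw [Complex.mul_conj, Complex.normSq_eq_norm_sq, hw]; simp

lemma MemLp.mul_of_norm_le_one {u w : ℝ → ℂ} (hu : MemLp u 2 bMeasure)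
    (hw : AEStronglyMeasurable w bMeasure) (hb : ∀ᵐ x ∂bMeasure, ‖w x‖ ≤ 1) :
    MemLp (fun x => u x * w x) 2 bMeasure :=
  hu.of_le (hu.1.mul hw) (hb.mono fun x hx => by
    rw [norm_mul]; exact mul_le_of_le_one_right (norm_nonneg _) hx)

lemma IsHardyBdry.mul_uc_pow {v : ℝ → ℂ} (hv : IsHardyBdry v) (n : ℕ) :
    IsHardyBdry fun x => v x * uc x ^ n := by
  refine ⟨MemLp.mul_of_norm_le_one hv.1 (continuous_uc.pow n).aestronglyMeasurable
    (ae_of_all _ fun x => by simp [norm_uc]), fun m => ?_⟩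
  rw [← hv.2 (n + m)]
  congr 1
  ext x
  ring

/-- Multiplication by a bounded Hardy boundary function. -/
lemma IsHardyBdry.mul_of_norm_le_one {u w : ℝ → ℂ} (hu : IsHardyBdry u) (hw : IsHardyBdry w)
    (hb : ∀ᵐ x ∂bMeasure, ‖w x‖ ≤ 1) : IsHardyBdry fun x => u x * w x := by
  refine ⟨MemLp.mul_of_norm_le_one hu.1 hw.1.1 hb, fun n => ?_⟩
  simp_rw [mul_assoc]
  rw [hu.integral_mul (hw.mul_uc_pow (n + 1)), hw.2 n, mul_zero, mul_zero]

/-- Division by the independent variable of a Hardy boundary function with mean zero. -/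
lemma IsHardyBdry.mul_uc_inv {v : ℝ → ℂ} (hv : IsHardyBdry v) (h0 : ∫ x, v x ∂bMeasure = 0) :
    IsHardyBdry fun x => v x * (uc x)⁻¹ := by
  refine ⟨MemLp.mul_of_norm_le_one hv.1 continuous_uc_inv.aestronglyMeasurable
    (ae_of_all _ fun x => by simp [norm_uc]), fun n => ?_⟩
  have e : ∀ x, v x * (uc x)⁻¹ * uc x ^ (n + 1) = v x * uc x ^ n := fun x => by
    rw [pow_succ', mul_assoc, inv_mul_cancel_left₀ (uc_ne_zero x)]
  simp_rw [e]
  cases n with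
  | zero => simpa using h0
  | succ n => exact hv.2 n

/-- A square integrable function annihilated by the Szegő projection is the conjugate of a Hardy
boundary function vanishing at the origin. -/
lemma isHardyBdry_conj_mul_uc_inv {u : ℝ → ℂ} (hu : MemLp u 2 bMeasure)
    (h : ∀ z ∈ unitDisk, szProj u z = 0) :
    IsHardyBdry fun x => (starRingEnd ℂ) (u x) * (uc x)⁻¹ := by
  refine ⟨MemLp.mul_of_norm_le_one (MemLp.conj_bMeasure hu) continuous_uc_inv.aestronglyMeasurable
    (ae_of_all _ fun x => by simp [norm_uc]), fun n => ?_⟩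
  have hc := (szProj_eq_zero_iff (hu.integrable (by norm_num))).1 h n
  have e : ∀ x, (starRingEnd ℂ) (u x) * (uc x)⁻¹ * uc x ^ (n + 1) =
      (starRingEnd ℂ) (u x * ((uc x)⁻¹) ^ n) := fun x => by
    rw [map_mul, map_pow, map_inv₀, conj_uc, inv_inv, pow_succ', mul_assoc,
      inv_mul_cancel_left₀ (uc_ne_zero x)]
  simp_rw [e]
  rw [integral_conj, hc, map_zero]

lemma IsHardyBdry.szProj_conj_mul_uc_inv {v : ℝ → ℂ} (hv : IsHardyBdry v) :
    ∀ z ∈ unitDisk, szProj (fun x => (starRingEnd ℂ) (v x) * (uc x)⁻¹) z = 0 := by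
  have hm := MemLp.mul_of_norm_le_one (MemLp.conj_bMeasure hv.1)
    continuous_uc_inv.aestronglyMeasurable (ae_of_all _ fun x => by simp [norm_uc])
  refine (szProj_eq_zero_iff (hm.integrable (by norm_num))).2 fun n => ?_
  have e : ∀ x, (starRingEnd ℂ) (v x) * (uc x)⁻¹ * ((uc x)⁻¹) ^ n =
      (starRingEnd ℂ) (v x * uc x ^ (n + 1)) := fun x => by
    rw [map_mul, map_pow, conj_uc, pow_succ']; ring
  simp_rw [e]
  rw [integral_conj, hv.2 n, map_zero]

lemma IsHardyBdry.bdry_szProj {v : ℝ → ℂ} (hv : IsHardyBdry v) :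
    bdry (szProj v) =ᵐ[bMeasure] v :=
  hv.ae_tendsto_szProj.mono fun _ hx => bdry_eq_of_tendsto hx

lemma IsInner.memH2 {I : ℂ → ℂ} (hI : IsInner I) : MemH2 I := by
  refine ⟨hI.1, 2 * Real.pi, fun r hr => ?_⟩
  rw [integral_eq_bMeasure]
  calc ∫ x, ‖I (r * uc x)‖ ^ 2 ∂bMeasure ≤ ∫ _, (1 : ℝ) ∂bMeasure := by
        refine integral_mono
          ((continuous_comp_mul_uc hI.1 hr.1 hr.2).norm.pow 2).integrable_bMeasure
          (integrable_const _) fun x => ?_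
        exact pow_le_one₀ (norm_nonneg _) (hI.2.1 _ (mul_uc_mem_unitDisk hr.1 hr.2 x))
    _ = 2 * Real.pi := by simp [bMeasure_univ]

lemma IsOuter.apply_zero_ne_zero {f : ℂ → ℂ} (hf : IsOuter f) : f 0 ≠ 0 := by
  obtain ⟨-, c, hc, h⟩ := hf
  rw [h 0 (mem_unitDisk.2 (by simp))]
  refine mul_ne_zero (fun h0 => ?_) (Complex.exp_ne_zero _)
  simp [h0] at hc

lemma IsOuter.log_norm_apply_zero {f : ℂ → ℂ} (hf : IsOuter f) :
    2 * Real.pi * Real.log ‖f 0‖ = ∫ x, Real.log ‖bdry f x‖ ∂bMeasure := by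
  obtain ⟨-, c, hc, h⟩ := hf
  have e : ∀ x, (uc x + 0) / (uc x - 0) * ((Real.log ‖bdry f x‖ : ℝ) : ℂ) =
      ((Real.log ‖bdry f x‖ : ℝ) : ℂ) := fun x => by
    rw [add_zero, sub_zero, div_self (uc_ne_zero x), one_mul]
  have h0 := h 0 (mem_unitDisk.2 (by simp))
  simp_rw [e] at h0
  rw [integral_eq_bMeasure, integral_complex_ofReal] at h0
  have e2 : (1 / (2 * (Real.pi : ℂ))) * ((∫ x, Real.log ‖bdry f x‖ ∂bMeasure : ℝ) : ℂ) =
      ((1 / (2 * Real.pi) * ∫ x, Real.log ‖bdry f x‖ ∂bMeasure : ℝ) : ℂ) := by push_cast; rfl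
  rw [h0, e2, norm_mul, hc, one_mul, Complex.norm_exp, Complex.ofReal_re, Real.log_exp]
  have := Real.pi_pos
  field_simp

/-- The boundary values of outer `H²` functions do not vanish. -/
lemma IsOuter.ae_bdry_ne_zero {f : ℂ → ℂ} (hf : IsOuter f) (hf2 : MemH2 f) :
    ∀ᵐ x ∂bMeasure, bdry f x ≠ 0 := by
  obtain ⟨hH, hP, -⟩ := hf2.isHardyBdry_bdry
  refine (hH.jensen ?_).1
  rw [← hP 0 (mem_unitDisk.2 (by simp))]
  exact hf.apply_zero_ne_zero

/-- A unimodular function whose mean has modulus at least one is constant. -/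
lemma ae_eq_const_of_one_le_norm_mean {w : ℝ → ℂ} (hw : Integrable w bMeasure)
    (h1 : ∀ᵐ x ∂bMeasure, ‖w x‖ = 1) {m : ℂ}
    (hm : 1 / (2 * (Real.pi : ℂ)) * ∫ x, w x ∂bMeasure = m) (hm1 : 1 ≤ ‖m‖) :
    ‖m‖ = 1 ∧ ∀ᵐ x ∂bMeasure, w x = m := by
  have hpi : (Real.pi : ℂ) ≠ 0 := Complex.ofReal_ne_zero.2 Real.pi_ne_zero
  have hwm : ∫ x, w x ∂bMeasure = 2 * Real.pi * m := by rw [← hm]; field_simp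
  have i1 : Integrable (fun x => ((starRingEnd ℂ) m * w x).re) bMeasure := (hw.const_mul _).re
  have hre : ∫ x, ((starRingEnd ℂ) m * w x).re ∂bMeasure = 2 * Real.pi * ‖m‖ ^ 2 := by
    have := integral_re (hw.const_mul ((starRingEnd ℂ) m))
    simp only [RCLike.re_to_complex] at this
    rw [this, integral_const_mul, hwm, ← Complex.normSq_eq_norm_sq,
      show (starRingEnd ℂ) m * (2 * Real.pi * m) = ((2 * Real.pi : ℝ) : ℂ) * (m * (starRingEnd ℂ) m)
        by push_cast; ring, Complex.mul_conj, ← Complex.ofReal_mul, Complex.ofReal_re]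
  have e : (fun x => ‖w x - m‖ ^ 2) =ᵐ[bMeasure]
      fun x => (1 + ‖m‖ ^ 2) - 2 * ((starRingEnd ℂ) m * w x).re := by
    filter_upwards [h1] with x hx
    have h2 : Complex.normSq (w x) = 1 := by rw [Complex.normSq_eq_norm_sq, hx, one_pow]
    rw [← Complex.normSq_eq_norm_sq, ← Complex.normSq_eq_norm_sq, Complex.normSq_sub, h2,
      mul_comm ((starRingEnd ℂ) m)]
  have i2 : Integrable (fun x => ‖w x - m‖ ^ 2) bMeasure :=
    ((integrable_const _).sub (i1.const_mul 2)).congr e.symm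
  have hval : ∫ x, ‖w x - m‖ ^ 2 ∂bMeasure = 2 * Real.pi * (1 - ‖m‖ ^ 2) := by
    rw [integral_congr_ae e, integral_sub (integrable_const _) (i1.const_mul 2),
      integral_const_mul, hre, integral_const, bMeasure_univ, smul_eq_mul]
    ring
  have hnn : 0 ≤ ∫ x, ‖w x - m‖ ^ 2 ∂bMeasure := integral_nonneg fun x => by positivity
  have hle : 2 * Real.pi * (1 - ‖m‖ ^ 2) ≤ 0 :=
    mul_nonpos_of_nonneg_of_nonpos (by positivity) (by nlinarith)
  have hz : ∫ x, ‖w x - m‖ ^ 2 ∂bMeasure = 0 := le_antisymm (hval.trans_le hle) hnn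
  refine ⟨?_, ?_⟩
  · rw [hval] at hz
    have : 1 - ‖m‖ ^ 2 = 0 := (mul_eq_zero.1 hz).resolve_left (by positivity)
    nlinarith
  · filter_upwards [(integral_eq_zero_iff_of_nonneg (fun x => by positivity) i2).1 hz] with x hx
    have : ‖w x - m‖ = 0 := pow_eq_zero_iff (two_ne_zero) |>.1 hx
    exact sub_eq_zero.1 (norm_eq_zero.1 this)

/-- If `ker T_{ḡ/g} = f K_I` for outer functions `f`, `g` of `H²` and an inner function `I`
vanishing at the origin, then `ḡ/g` is a unimodular multiple of `Ī f̄ / f`. -/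
theorem symbQuot_ae_eq_of_toeplitzKer_eq {I f g : ℂ → ℂ} (hI : IsInner I) (hI0 : I 0 = 0)
    (hf2 : MemH2 f) (hfout : IsOuter f) (hg2 : MemH2 g) (hgout : IsOuter g)
    (hker : toeplitzKer (symbQuot g) = fModel f I) :
    ∃ m : ℂ, ‖m‖ = 1 ∧ ∀ᵐ θ ∂bMeasure, symbQuot g θ =
      m * (starRingEnd ℂ) (bdry I θ) * (starRingEnd ℂ) (bdry f θ) / bdry f θ := by
  have hpi : (Real.pi : ℂ) ≠ 0 := Complex.ofReal_ne_zero.2 Real.pi_ne_zero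
  have hz0 : (0 : ℂ) ∈ unitDisk := mem_unitDisk.2 (by simp)
  obtain ⟨hIH, hIP, -⟩ := hI.memH2.isHardyBdry_bdry
  obtain ⟨hfH, hfP, hfL⟩ := hf2.isHardyBdry_bdry
  have hI1 : ∀ᵐ x ∂bMeasure, ‖bdry I x‖ = 1 := hI.2.2
  have hIle : ∀ᵐ x ∂bMeasure, ‖bdry I x‖ ≤ 1 := hI1.mono fun x hx => hx.le
  have hIm : ∫ x, bdry I x ∂bMeasure = 0 := by
    have h := hIP 0 hz0
    rw [hI0, szProj_zero_apply] at h
    exact (mul_eq_zero.1 h.symm).resolve_left (by simp [Real.pi_ne_zero])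
  have hfne := hfout.ae_bdry_ne_zero hf2
  have hgne := hgout.ae_bdry_ne_zero hg2
  have hq1 : ∀ᵐ x ∂bMeasure, ‖symbQuot g x‖ = 1 := hgne.mono fun x hx => by
    rw [symbQuot, norm_div, RCLike.norm_conj, div_self (norm_ne_zero_iff.2 hx)]
  have hqm : AEStronglyMeasurable (symbQuot g) bMeasure := by
    have hgm := hg2.isHardyBdry_bdry.1.1.1.aemeasurable
    exact ((Complex.continuous_conj.measurable.comp_aemeasurable hgm).div hgm).aestronglyMeasurable
  -- the kernel element `f · (I / z)`
  have hh1 : IsHardyBdry fun x => bdry I x * (uc x)⁻¹ := hIH.mul_uc_inv hIm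
  obtain ⟨H, hH⟩ : ∃ H, H = szProj fun x => bdry I x * (uc x)⁻¹ := ⟨_, rfl⟩
  have hHb : bdry H =ᵐ[bMeasure] fun x => bdry I x * (uc x)⁻¹ := hH ▸ hh1.bdry_szProj
  have hHK : H ∈ modelSpace I := by
    refine ⟨hH ▸ hh1.memH2_szProj, fun z hz => ?_⟩
    have e : (fun θ => conjBdry I θ * bdry H θ) =ᵐ[bMeasure]
        fun x => (starRingEnd ℂ) (1 : ℂ) * (uc x)⁻¹ := by
      filter_upwards [hHb, hI1] with x h1 h2
      rw [h1, conjBdry, ← mul_assoc, mul_comm ((starRingEnd ℂ) _), mul_conj_eq_one h2, map_one]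
    have h1H : IsHardyBdry fun _ => (1 : ℂ) := ⟨memLp_const _, fun n => by
      simp_rw [one_mul, uc_pow_eq_zpow]
      rw [integral_uc_zpow, if_neg (by omega)]⟩
    rw [toeplitz, szProj_congr_ae e]
    exact h1H.szProj_conj_mul_uc_inv z hz
  have hF1 : (fun z => f z * H z) ∈ toeplitzKer (symbQuot g) := hker ▸ ⟨H, hHK, fun z _ => rfl⟩
  have hF1b : bdry (fun z => f z * H z) =ᵐ[bMeasure]
      fun x => bdry f x * (bdry I x * (uc x)⁻¹) := by
    filter_upwards [hfL, hHK.1.isHardyBdry_bdry.2.2, hHb] with x h1 h2 h3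
    rw [bdry_eq_of_tendsto (h1.mul h2), h3]
  obtain ⟨u, hu⟩ : ∃ u : ℝ → ℂ,
    u = fun x => symbQuot g x * bdry (fun z => f z * H z) x := ⟨_, rfl⟩
  have huL : MemLp u 2 bMeasure := by
    have := MemLp.mul_of_norm_le_one hF1.1.isHardyBdry_bdry.1.1 hqm (hq1.mono fun x hx => hx.le)
    rw [hu]
    simpa only [mul_comm] using this
  have huz : ∀ z ∈ unitDisk, szProj u z = 0 := by
    rw [hu]; exact hF1.2
  obtain ⟨k, hk⟩ : ∃ k : ℝ → ℂ, k = fun x => (starRingEnd ℂ) (u x) * (uc x)⁻¹ := ⟨_, rfl⟩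
  have hkH : IsHardyBdry k := hk ▸ isHardyBdry_conj_mul_uc_inv huL huz
  have hkv : ∀ᵐ x ∂bMeasure, k x = (starRingEnd ℂ) (symbQuot g x) *
      ((starRingEnd ℂ) (bdry f x) * (starRingEnd ℂ) (bdry I x)) := by
    filter_upwards [hF1b] with x h1
    rw [hk, hu]
    simp only [h1, map_mul, map_inv₀, conj_uc, inv_inv]
    have := uc_ne_zero x
    field_simp
  -- the kernel element with boundary values `k · I / z`
  have hvH : IsHardyBdry fun x => k x * bdry I x * (uc x)⁻¹ :=
    (hkH.mul_of_norm_le_one hIH hIle).mul_uc_inv (by rw [hkH.integral_mul hIH, hIm]; simp)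
  obtain ⟨F, hF⟩ : ∃ F, F = szProj fun x => k x * bdry I x * (uc x)⁻¹ := ⟨_, rfl⟩
  have hFb : bdry F =ᵐ[bMeasure] fun x => k x * bdry I x * (uc x)⁻¹ := hF ▸ hvH.bdry_szProj
  have hFker : F ∈ toeplitzKer (symbQuot g) := by
    refine ⟨hF ▸ hvH.memH2_szProj, fun z hz => ?_⟩
    have e : (fun θ => symbQuot g θ * bdry F θ) =ᵐ[bMeasure]
        fun x => (starRingEnd ℂ) (bdry f x) * (uc x)⁻¹ := by
      filter_upwards [hFb, hI1, hq1, hkv] with x h1 h2 h3 h4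
      rw [h1, h4]
      have h5 := mul_conj_eq_one h2
      have h6 := mul_conj_eq_one h3
      linear_combination (starRingEnd ℂ (bdry f x) * (uc x)⁻¹) *
        (symbQuot g x * starRingEnd ℂ (symbQuot g x) * h5 + h6)
    rw [toeplitz, szProj_congr_ae e]
    exact hfH.szProj_conj_mul_uc_inv z hz
  rw [hker] at hFker
  obtain ⟨h, hhK, hFh⟩ := hFker
  have hFb2 : ∀ᵐ x ∂bMeasure, bdry f x * bdry h x = k x * bdry I x * (uc x)⁻¹ := by
    filter_upwards [hfL, hhK.1.isHardyBdry_bdry.2.2, hFb] with x h1 h2 h3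
    rw [← h3]
    refine (bdry_eq_of_tendsto ((h1.mul h2).congr' ?_)).symm
    filter_upwards [self_mem_nhdsWithin,
      nhdsWithin_le_nhds (Ioi_mem_nhds (zero_lt_one (α := ℝ)))] with r hr1 hr0
    exact (hFh _ (mul_uc_mem_unitDisk (le_of_lt hr0) hr1 x)).symm
  -- the unimodular factor of the boundary values of `f`
  obtain ⟨w, hw⟩ : ∃ w : ℝ → ℂ, w = fun x =>
    (starRingEnd ℂ) (conjBdry I x * bdry h x) * (uc x)⁻¹ := ⟨_, rfl⟩
  have hwH : IsHardyBdry w := by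
    rw [hw]
    refine isHardyBdry_conj_mul_uc_inv ?_ hhK.2
    have := MemLp.mul_of_norm_le_one hhK.1.isHardyBdry_bdry.1.1
      (Complex.continuous_conj.comp_aestronglyMeasurable hIH.1.1)
      (hIle.mono fun x hx => by rwa [RCLike.norm_conj])
    simpa only [mul_comm, conjBdry] using this
  have hwv : ∀ᵐ x ∂bMeasure, (starRingEnd ℂ) (bdry f x) * w x =
      symbQuot g x * bdry f x * bdry I x := by
    filter_upwards [hFb2, hkv, hI1] with x h1 h2 h3
    rw [h2] at h1
    have h4 := congrArg (starRingEnd ℂ) h1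
    simp only [map_mul, map_inv₀, conj_uc, inv_inv, Complex.conj_conj] at h4
    rw [hw]
    simp only [conjBdry, map_mul, Complex.conj_conj]
    have h5 := mul_conj_eq_one h3
    have h6 := mul_inv_cancel₀ (uc_ne_zero x)
    linear_combination (bdry I x * (uc x)⁻¹) * h4 +
      (symbQuot g x * bdry f x * bdry I x) * (h5 * (uc x * (uc x)⁻¹) + h6)
  have hwk : ∀ᵐ x ∂bMeasure, w x * k x = bdry f x := by
    filter_upwards [hwv, hkv, hI1, hq1] with x h1 h2 h3 h4
    have h5 := mul_conj_eq_one h3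
    have h6 := mul_conj_eq_one h4
    rw [h2]
    linear_combination (starRingEnd ℂ (symbQuot g x) * starRingEnd ℂ (bdry I x)) * h1 +
      bdry f x * (symbQuot g x * starRingEnd ℂ (symbQuot g x) * h5 + h6)
  have hkn : ∀ᵐ x ∂bMeasure, ‖k x‖ = ‖bdry f x‖ := by
    filter_upwards [hkv, hI1, hq1] with x h1 h2 h3
    rw [h1, norm_mul, norm_mul, RCLike.norm_conj, RCLike.norm_conj, RCLike.norm_conj, h2, h3]
    ring
  have hwn : ∀ᵐ x ∂bMeasure, ‖w x‖ = 1 := by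
    filter_upwards [hwk, hkn, hfne] with x h1 h2 h3
    have := congrArg norm h1
    rw [norm_mul, h2] at this
    exact (mul_eq_right₀ (norm_ne_zero_iff.2 h3)).1 this
  have hprod : f 0 = szProj w 0 * szProj k 0 := by
    rw [hfP 0 hz0, szProj_zero_apply, szProj_zero_apply, szProj_zero_apply,
      ← integral_congr_ae hwk, hwH.integral_mul hkH]
    ring
  have hf0 := hfout.apply_zero_ne_zero
  have hk0 : szProj k 0 ≠ 0 := fun h0 => hf0 (by rw [hprod, h0, mul_zero])
  have hkle : ‖szProj k 0‖ ≤ ‖f 0‖ := by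
    have hJ := (hkH.jensen hk0).2.2
    rw [integral_congr_ae (hkn.mono fun x hx => by simp only [hx] :
      (fun x => Real.log ‖k x‖) =ᵐ[bMeasure] fun x => Real.log ‖bdry f x‖),
      ← hfout.log_norm_apply_zero] at hJ
    exact (Real.log_le_log_iff (norm_pos_iff.2 hk0) (norm_pos_iff.2 hf0)).1
      (le_of_mul_le_mul_left hJ (by positivity))
  have hw0 : 1 ≤ ‖szProj w 0‖ := by
    rw [hprod, norm_mul] at hkle
    exact le_of_mul_le_mul_right (by rwa [one_mul]) (norm_pos_iff.2 hk0)
  obtain ⟨hm1, hmw⟩ := ae_eq_const_of_one_le_norm_mean hwH.integrable hwn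
    (szProj_zero_apply w).symm hw0
  refine ⟨szProj w 0, hm1, ?_⟩
  filter_upwards [hmw, hwv, hI1, hfne] with x h1 h2 h3 h4
  rw [h1] at h2
  have h5 := mul_conj_eq_one h3
  rw [eq_div_iff h4]
  linear_combination (-starRingEnd ℂ (bdry I x)) * h2 - (symbQuot g x * bdry f x) * h5

/-- first step of the proof of Theorem 1.  Let `I` be inner with
`I(0)=0` and `f` outer of unit norm with associated pair `(I·b₀, a)`, with `(b₀, a)`
special and `(a/(1−b₀))²` rigid.  If `g ∈ H²` is outer and `ker T_{ḡ/g} = f·K_I`,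
then `ḡ/g = Ī f̄ / f` a.e. on `∂𝔻`, after replacing `I` by a unimodular constant
multiple. -/
theorem symbol_identification (I b₀ a f g : ℂ → ℂ)
    (hI : IsInner I) (hI0 : I 0 = 0)
    (hpair : PairAssoc f (fun z => I z * b₀ z) a)
    (hspec : SpecialPair b₀ a)
    (hrigid : Rigid (fun z => (a z / (1 - b₀ z)) ^ 2))
    (hg2 : MemH2 g) (hgout : IsOuter g)
    (hker : toeplitzKer (symbQuot g) = fModel f I) :
    ∃ c : ℂ, ‖c‖ = 1 ∧
      ∀ᵐ θ ∂bMeasure,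
        (starRingEnd ℂ) (bdry g θ) / bdry g θ
          = (starRingEnd ℂ) (c * bdry I θ) * (starRingEnd ℂ) (bdry f θ) / bdry f θ := by
  obtain ⟨m, hm, h⟩ := symbQuot_ae_eq_of_toeplitzKer_eq hI hI0 hpair.2.1 hpair.1 hg2 hgout hker
  refine ⟨(starRingEnd ℂ) m, by rwa [RCLike.norm_conj], h.mono fun θ hθ => ?_⟩
  rw [map_mul, Complex.conj_conj]
  exact hθ

end
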